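/- arXiv:1408.5030 — 10 statements merged into one kernel-verified Lean document; each statement's English description precedes it below -/
import Mathlib

section
/- Let (u,v,ϱ,P) be a classical solution of the steady Euler equations on an open set Ω ⊆ ℝ², and let ψ : Ω → ℝ be a C² pseudo relative stream function, i.e. ∂ₓψ = −√ϱ v and ∂_yψ = √ϱ(u−c). Then the gradient of the energy density E := P + (ϱ/2)((u−c)² + v²) + gϱy satisfies the pointwise identity ∇E = (Δψ)∇ψ + g y ∇ϱ throughout Ω. -/
/-- First partial derivative (in the horizontal variable `x`) of `f : ℝ × ℝ → ℝ`. -/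
noncomputable def pd1 (f : ℝ × ℝ → ℝ) (z : ℝ × ℝ) : ℝ := fderiv ℝ f z (1, 0)

/-- Second partial derivative (in the vertical variable `y`) of `f : ℝ × ℝ → ℝ`. -/
noncomputable def pd2 (f : ℝ × ℝ → ℝ) (z : ℝ × ℝ) : ℝ := fderiv ℝ f z (0, 1)

/-- The product rule for `√ϱ f` where `ϱ > 0`, multiplied by `√ϱ` to clear the square root from the
denominator. -/
theorem fderiv_sqrt_mul_apply_mul_sqrt {E : Type*} [NormedAddCommGroup E] [NormedSpace ℝ E]
    {ϱ f : E → ℝ} {z : E} (hϱ : DifferentiableAt ℝ ϱ z) (hf : DifferentiableAt ℝ f z)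
    (hpos : 0 < ϱ z) (e : E) :
    fderiv ℝ (fun w => Real.sqrt (ϱ w) * f w) z e * Real.sqrt (ϱ z)
      = ϱ z * fderiv ℝ f z e + f z * fderiv ℝ ϱ z e / 2 := by
  have hs : Real.sqrt (ϱ z) ≠ 0 := (Real.sqrt_pos.2 hpos).ne'
  have hsq : Real.sqrt (ϱ z) ^ 2 = ϱ z := Real.sq_sqrt hpos.le
  have h := (hϱ.hasFDerivAt.sqrt hpos.ne').mul hf.hasFDerivAt
  rw [show fderiv ℝ (fun w => Real.sqrt (ϱ w) * f w) z = _ from h.fderiv]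
  simp only [add_apply, smul_apply, smul_eq_mul]
  field_simp
  rw [hsq]
  ring

/-- The derivative of the energy density `P + (ϱ/2)((u−c)² + v²) + gϱy`, in any direction. -/
theorem fderiv_energy_apply {u v ϱ P : ℝ × ℝ → ℝ} {z : ℝ × ℝ} (c g : ℝ)
    (hu : DifferentiableAt ℝ u z) (hv : DifferentiableAt ℝ v z)
    (hϱ : DifferentiableAt ℝ ϱ z) (hP : DifferentiableAt ℝ P z) (e : ℝ × ℝ) :
    fderiv ℝ (fun w => P w + ϱ w / 2 * ((u w - c) ^ 2 + (v w) ^ 2) + g * ϱ w * w.2) z e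
      = fderiv ℝ P z e + fderiv ℝ ϱ z e / 2 * ((u z - c) ^ 2 + (v z) ^ 2)
        + ϱ z * ((u z - c) * fderiv ℝ u z e + v z * fderiv ℝ v z e)
        + g * (fderiv ℝ ϱ z e * z.2 + ϱ z * e.2) := by
  have h := (hP.hasFDerivAt.add ((hϱ.hasFDerivAt.mul_const (2⁻¹ : ℝ)).mul
    (((hu.hasFDerivAt.sub_const c).pow 2).add (hv.hasFDerivAt.pow 2)))).add
    ((hϱ.hasFDerivAt.const_mul g).mul (hasFDerivAt_snd (𝕜 := ℝ) (p := z)))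
  rw [show fderiv ℝ (fun w => P w + ϱ w / 2 * ((u w - c) ^ 2 + (v w) ^ 2) + g * ϱ w * w.2) z = _
    from h.fderiv]
  simp
  ring

/-- For a classical solution `(u,v,ϱ,P)` of the steady Euler equations with C² pseudo relative
stream function `ψ` (`∂ₓψ = −√ϱ v`, `∂_yψ = √ϱ(u−c)`), the gradient of the energy density
`E := P + (ϱ/2)((u−c)² + v²) + gϱy` satisfies `∇E = (Δψ)∇ψ + g y ∇ϱ` throughout `Ω`. -/
theorem gradient_energy_identity
    (Ω : Set (ℝ × ℝ)) (hΩ : IsOpen Ω) (c g : ℝ)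
    (u v ϱ P ψ : ℝ × ℝ → ℝ)
    (hu : ContDiffOn ℝ 1 u Ω) (hv : ContDiffOn ℝ 1 v Ω)
    (hϱ : ContDiffOn ℝ 1 ϱ Ω) (hP : ContDiffOn ℝ 1 P Ω)
    (hψ : ContDiffOn ℝ 2 ψ Ω)
    (hϱpos : ∀ z ∈ Ω, 0 < ϱ z)
    (hincomp : ∀ z ∈ Ω, pd1 u z + pd2 v z = 0)
    (hmass : ∀ z ∈ Ω, (u z - c) * pd1 ϱ z + v z * pd2 ϱ z = 0)
    (hmomx : ∀ z ∈ Ω, ϱ z * ((u z - c) * pd1 u z + v z * pd2 u z) = -pd1 P z)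
    (hmomy : ∀ z ∈ Ω, ϱ z * ((u z - c) * pd1 v z + v z * pd2 v z) = -pd2 P z - g * ϱ z)
    (hψx : ∀ z ∈ Ω, pd1 ψ z = -(Real.sqrt (ϱ z) * v z))
    (hψy : ∀ z ∈ Ω, pd2 ψ z = Real.sqrt (ϱ z) * (u z - c)) :
    ∀ z ∈ Ω,
      pd1 (fun w => P w + ϱ w / 2 * ((u w - c) ^ 2 + (v w) ^ 2) + g * ϱ w * w.2) z
          = (pd1 (pd1 ψ) z + pd2 (pd2 ψ) z) * pd1 ψ z + g * z.2 * pd1 ϱ z ∧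
      pd2 (fun w => P w + ϱ w / 2 * ((u w - c) ^ 2 + (v w) ^ 2) + g * ϱ w * w.2) z
          = (pd1 (pd1 ψ) z + pd2 (pd2 ψ) z) * pd2 ψ z + g * z.2 * pd2 ϱ z := by
  intro z hz
  have hnhds : Ω ∈ nhds z := hΩ.mem_nhds hz
  have du : DifferentiableAt ℝ u z := (hu.contDiffAt hnhds).differentiableAt one_ne_zero
  have dv : DifferentiableAt ℝ v z := (hv.contDiffAt hnhds).differentiableAt one_ne_zero
  have dϱ : DifferentiableAt ℝ ϱ z := (hϱ.contDiffAt hnhds).differentiableAt one_ne_zero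
  have dP : DifferentiableAt ℝ P z := (hP.contDiffAt hnhds).differentiableAt one_ne_zero
  have eψx : pd1 ψ =ᶠ[nhds z] fun w => Real.sqrt (ϱ w) * -v w := by
    filter_upwards [hnhds] with w hw
    rw [hψx w hw, mul_neg]
  have eψy : pd2 ψ =ᶠ[nhds z] fun w => Real.sqrt (ϱ w) * (u w - c) := by
    filter_upwards [hnhds] with w hw
    exact hψy w hw
  have hxx : pd1 (pd1 ψ) z * Real.sqrt (ϱ z) = -(ϱ z * pd1 v z) - v z * pd1 ϱ z / 2 := by
    have h := fderiv_sqrt_mul_apply_mul_sqrt dϱ dv.fun_neg (hϱpos z hz) (1, 0)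
    rw [← eψx.fderiv_eq, fderiv_fun_neg, neg_apply] at h
    simp only [pd1] at h ⊢
    linear_combination h
  have hyy : pd2 (pd2 ψ) z * Real.sqrt (ϱ z) = ϱ z * pd2 u z + (u z - c) * pd2 ϱ z / 2 := by
    have h := fderiv_sqrt_mul_apply_mul_sqrt dϱ (du.sub_const c) (hϱpos z hz) (0, 1)
    rwa [← eψy.fderiv_eq, fderiv_sub_const] at h
  have hmass := hmass z hz
  have hmomx := hmomx z hz
  have hmomy := hmomy z hz
  rw [hψx z hz, hψy z hz]
  constructor
  · have hE : pd1 _ z = pd1 P z + pd1 ϱ z / 2 * ((u z - c) ^ 2 + (v z) ^ 2)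
        + ϱ z * ((u z - c) * pd1 u z + v z * pd1 v z)
        + g * (pd1 ϱ z * z.2 + ϱ z * 0) :=
      fderiv_energy_apply c g du dv dϱ dP (1, 0)
    rw [hE]
    linear_combination v z * (hxx + hyy) + hmomx + (u z - c) / 2 * hmass
  · have hE : pd2 _ z = pd2 P z + pd2 ϱ z / 2 * ((u z - c) ^ 2 + (v z) ^ 2)
        + ϱ z * ((u z - c) * pd2 u z + v z * pd2 v z)
        + g * (pd2 ϱ z * z.2 + ϱ z * 1) :=
      fderiv_energy_apply c g du dv dϱ dP (0, 1)
    rw [hE]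
    linear_combination -(u z - c) * (hxx + hyy) + hmomy + v z / 2 * hmass
end

section
/- Let (u,v,ϱ,P) be a classical solution of the steady Euler equations on an open set Ω ⊆ ℝ², let ψ : Ω → ℝ be a C² pseudo relative stream function (∂ₓψ = −√ϱ v, ∂_yψ = √ϱ(u−c)) with no horizontal stagnation, ∂_yψ < 0 on Ω, and suppose there exist continuously differentiable functions ρ, B : ℝ → ℝ such that ϱ(x,y) = ρ(−ψ(x,y)) and E(x,y) = B(−ψ(x,y)) on Ω, where E := P + (ϱ/2)((u−c)² + v²) + gϱy. Then ψ satisfies Yih's equation: Δψ(x,y) − g y ρ′(−ψ(x,y)) + B′(−ψ(x,y)) = 0 for every (x,y) ∈ Ω. -/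
/-- For a classical solution `(u,v,ϱ,P)` of the steady Euler equations with C² pseudo relative
stream function `ψ`, no horizontal stagnation `∂_yψ < 0`, streamline density `ϱ = ρ∘(−ψ)` and
energy `E = B∘(−ψ)`, the stream function satisfies Yih's equation
`Δψ − g y ρ′(−ψ) + B′(−ψ) = 0` throughout `Ω`. -/
theorem yih_equation
    (Ω : Set (ℝ × ℝ)) (hΩ : IsOpen Ω) (c g : ℝ)
    (u v ϱ P ψ : ℝ × ℝ → ℝ) (ρ B : ℝ → ℝ)
    (hu : ContDiffOn ℝ 1 u Ω) (hv : ContDiffOn ℝ 1 v Ω)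
    (hϱ : ContDiffOn ℝ 1 ϱ Ω) (hP : ContDiffOn ℝ 1 P Ω)
    (hψ : ContDiffOn ℝ 2 ψ Ω)
    (hρ : ContDiff ℝ 1 ρ) (hB : ContDiff ℝ 1 B)
    (hϱpos : ∀ z ∈ Ω, 0 < ϱ z)
    (hincomp : ∀ z ∈ Ω, pd1 u z + pd2 v z = 0)
    (hmass : ∀ z ∈ Ω, (u z - c) * pd1 ϱ z + v z * pd2 ϱ z = 0)
    (hmomx : ∀ z ∈ Ω, ϱ z * ((u z - c) * pd1 u z + v z * pd2 u z) = -pd1 P z)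
    (hmomy : ∀ z ∈ Ω, ϱ z * ((u z - c) * pd1 v z + v z * pd2 v z) = -pd2 P z - g * ϱ z)
    (hψx : ∀ z ∈ Ω, pd1 ψ z = -(Real.sqrt (ϱ z) * v z))
    (hψy : ∀ z ∈ Ω, pd2 ψ z = Real.sqrt (ϱ z) * (u z - c))
    (hstag : ∀ z ∈ Ω, pd2 ψ z < 0)
    (hϱρ : ∀ z ∈ Ω, ϱ z = ρ (-ψ z))
    (hEB : ∀ z ∈ Ω,
      P z + ϱ z / 2 * ((u z - c) ^ 2 + (v z) ^ 2) + g * ϱ z * z.2 = B (-ψ z)) :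
    ∀ z ∈ Ω,
      (pd1 (pd1 ψ) z + pd2 (pd2 ψ) z) - g * z.2 * deriv ρ (-ψ z) + deriv B (-ψ z) = 0 := by
  intro z hz
  have hΩz : Ω ∈ nhds z := hΩ.mem_nhds hz
  have du := ((hu.contDiffAt hΩz).differentiableAt one_ne_zero).hasFDerivAt
  have dv := ((hv.contDiffAt hΩz).differentiableAt one_ne_zero).hasFDerivAt
  have dϱ := ((hϱ.contDiffAt hΩz).differentiableAt one_ne_zero).hasFDerivAt
  have dP := ((hP.contDiffAt hΩz).differentiableAt one_ne_zero).hasFDerivAt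
  have dψ := ((hψ.contDiffAt hΩz).differentiableAt two_ne_zero).hasFDerivAt
  have dρ := ((hρ.differentiable one_ne_zero) (-ψ z)).hasDerivAt
  have dB := ((hB.differentiable one_ne_zero) (-ψ z)).hasDerivAt
  have ds := dϱ.sqrt (hϱpos z hz).ne'
  have hxx : pd1 (pd1 ψ) z =
      -(√(ϱ z) * pd1 v z + v z * (1 / (2 * √(ϱ z)) * pd1 ϱ z)) := by
    have e : pd1 ψ =ᶠ[nhds z] fun w => -(√(ϱ w) * v w) := by
      filter_upwards [hΩz] with w hw using hψx w hw
    rw [pd1, e.fderiv_eq, (ds.fun_mul dv).fun_neg.fderiv]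
    simp [pd1]
  have hyy : pd2 (pd2 ψ) z =
      √(ϱ z) * pd2 u z + (u z - c) * (1 / (2 * √(ϱ z)) * pd2 ϱ z) := by
    have e : pd2 ψ =ᶠ[nhds z] fun w => √(ϱ w) * (u w - c) := by
      filter_upwards [hΩz] with w hw using hψy w hw
    rw [pd2, e.fderiv_eq, (ds.fun_mul (du.sub_const c)).fderiv]
    simp [pd2]
  have hϱy : pd2 ϱ z = -(deriv ρ (-ψ z) * pd2 ψ z) := by
    have e : ϱ =ᶠ[nhds z] fun w => ρ (-ψ w) := by
      filter_upwards [hΩz] with w hw using hϱρ w hw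
    have d : HasFDerivAt (fun w => ρ (-ψ w)) _ z := dρ.comp_hasFDerivAt z dψ.fun_neg
    rw [pd2, e.fderiv_eq, d.fderiv]
    simp [pd2]
  have hEy : pd2 P z + (ϱ z * ((u z - c) * pd2 u z + v z * pd2 v z)
      + pd2 ϱ z / 2 * ((u z - c) ^ 2 + v z ^ 2)) + (g * ϱ z + g * pd2 ϱ z * z.2)
      = -(deriv B (-ψ z) * pd2 ψ z) := by
    have e : (fun w => P w + ϱ w / 2 * ((u w - c) ^ 2 + v w ^ 2) + g * ϱ w * w.2)
        =ᶠ[nhds z] fun w => B (-ψ w) := by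
      filter_upwards [hΩz] with w hw using hEB w hw
    have d : HasFDerivAt (fun w => B (-ψ w)) _ z := dB.comp_hasFDerivAt z dψ.fun_neg
    have dE := (dP.fun_add ((dϱ.mul_const (2⁻¹ : ℝ)).fun_mul
      (((du.sub_const c).pow 2).fun_add (dv.pow 2)))).fun_add
      ((dϱ.const_mul g).fun_mul (hasFDerivAt_snd (𝕜 := ℝ) (p := z)))
    have h := congrArg (fun L : ℝ × ℝ →L[ℝ] ℝ => L (0, 1))
      (dE.unique (d.congr_of_eventuallyEq e))
    simp at h
    simp only [pd2]
    linear_combination h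
  have hs : 0 < √(ϱ z) := Real.sqrt_pos.2 (hϱpos z hz)
  have hsq : √(ϱ z) ^ 2 = ϱ z := Real.sq_sqrt (hϱpos z hz).le
  have hne : pd2 ψ z ≠ 0 := (hstag z hz).ne
  have hm := hmass z hz
  have hy := hmomy z hz
  have hψyz := hψy z hz
  rw [hxx, hyy]
  refine mul_left_cancel₀ hne ?_
  have key : √(ϱ z) * (u z - c) * (-(√(ϱ z) * pd1 v z + v z * (1 / (2 * √(ϱ z)) * pd1 ϱ z))
      + (√(ϱ z) * pd2 u z + (u z - c) * (1 / (2 * √(ϱ z)) * pd2 ϱ z)))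
      = √(ϱ z) ^ 2 * (u z - c) * (pd2 u z - pd1 v z)
        + (u z - c) * ((u z - c) * pd2 ϱ z - v z * pd1 ϱ z) / 2 := by
    field_simp
    ring
  rw [hsq, ← hψyz] at key
  linear_combination key + hEy - hy - g * z.2 * hϱy - v z / 2 * hm
end

section
/- Conversely, solutions of Yih's equation generate classical solutions of the steady Euler equations: let Ω ⊆ ℝ² be open, c, g, C₀ real constants, ψ : Ω → ℝ twice continuously differentiable, and ρ, B : ℝ → ℝ continuously differentiable with ρ(−ψ(x,y)) > 0 on Ω. Suppose Yih's equation holds: Δψ = g y ρ′(−ψ) − B′(−ψ) in Ω. Define ϱ := ρ∘(−ψ), u := c + (∂_yψ)/√ϱ, v := −(∂ₓψ)/√ϱ, and P := C₀ − |∇ψ|²/2 − gϱy + B(−ψ). Then on Ω: ∂ₓu + ∂_yv = 0, (u−c)∂ₓϱ + v∂_yϱ = 0, ϱ[(u−c)∂ₓu + v∂_yu] = −∂ₓP, and ϱ[(u−c)∂ₓv + v∂_yv] = −∂_yP − gϱ. -/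
theorem HasFDerivAt.pd1_eq {f : ℝ × ℝ → ℝ} {f' : ℝ × ℝ →L[ℝ] ℝ} {z : ℝ × ℝ}
    (h : HasFDerivAt f f' z) : pd1 f z = f' (1, 0) := by
  rw [pd1, h.fderiv]

theorem HasFDerivAt.pd2_eq {f : ℝ × ℝ → ℝ} {f' : ℝ × ℝ →L[ℝ] ℝ} {z : ℝ × ℝ}
    (h : HasFDerivAt f f' z) : pd2 f z = f' (0, 1) := by
  rw [pd2, h.fderiv]

theorem ContDiffAt.differentiableAt_pd1 {ψ : ℝ × ℝ → ℝ} {z : ℝ × ℝ}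
    (h : ContDiffAt ℝ 2 ψ z) : DifferentiableAt ℝ (pd1 ψ) z :=
  ((h.fderiv_right (m := 1) (by norm_num)).differentiableAt (by norm_num)).clm_apply
    (differentiableAt_const _)

theorem ContDiffAt.differentiableAt_pd2 {ψ : ℝ × ℝ → ℝ} {z : ℝ × ℝ}
    (h : ContDiffAt ℝ 2 ψ z) : DifferentiableAt ℝ (pd2 ψ) z :=
  ((h.fderiv_right (m := 1) (by norm_num)).differentiableAt (by norm_num)).clm_apply
    (differentiableAt_const _)

/-- Mixed second partial derivatives of a `C²` function commute. -/
theorem ContDiffAt.pd1_pd2_comm {ψ : ℝ × ℝ → ℝ} {z : ℝ × ℝ}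
    (h : ContDiffAt ℝ 2 ψ z) : pd1 (pd2 ψ) z = pd2 (pd1 ψ) z := by
  have hd := ((h.fderiv_right (m := 1) (by norm_num)).differentiableAt
    (by norm_num)).hasFDerivAt
  have h1 : HasFDerivAt (pd1 ψ) _ z := hd.clm_apply (hasFDerivAt_const (1, 0) z)
  have h2 : HasFDerivAt (pd2 ψ) _ z := hd.clm_apply (hasFDerivAt_const (0, 1) z)
  rw [h1.pd2_eq, h2.pd1_eq]
  simpa using (h.isSymmSndFDerivAt (by simp)).eq (1, 0) (0, 1)

/-- Solutions of Yih's equation generate classical solutions of the steady Euler equations: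
if `Δψ = g y ρ′(−ψ) − B′(−ψ)` on `Ω` with `ρ(−ψ) > 0`, then `ϱ := ρ∘(−ψ)`,
`u := c + ψ_y/√ϱ`, `v := −ψ_x/√ϱ`, and `P := C₀ − |∇ψ|²/2 − gϱy + B(−ψ)` satisfy
incompressibility, conservation of mass, and conservation of momentum on `Ω`. -/
theorem yih_generates_euler
    (Ω : Set (ℝ × ℝ)) (hΩ : IsOpen Ω) (c g C₀ : ℝ)
    (ψ : ℝ × ℝ → ℝ) (hψ : ContDiffOn ℝ 2 ψ Ω)
    (ρ B : ℝ → ℝ) (hρ : ContDiff ℝ 1 ρ) (hB : ContDiff ℝ 1 B)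
    (hpos : ∀ z ∈ Ω, 0 < ρ (-ψ z))
    (hYih : ∀ z ∈ Ω,
      pd1 (pd1 ψ) z + pd2 (pd2 ψ) z = g * z.2 * deriv ρ (-ψ z) - deriv B (-ψ z)) :
    let ϱ : ℝ × ℝ → ℝ := fun z => ρ (-ψ z)
    let u : ℝ × ℝ → ℝ := fun z => c + pd2 ψ z / Real.sqrt (ϱ z)
    let v : ℝ × ℝ → ℝ := fun z => -(pd1 ψ z) / Real.sqrt (ϱ z)
    let P : ℝ × ℝ → ℝ := fun z =>
      C₀ - ((pd1 ψ z) ^ 2 + (pd2 ψ z) ^ 2) / 2 - g * ϱ z * z.2 + B (-ψ z)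
    ∀ z ∈ Ω,
      pd1 u z + pd2 v z = 0 ∧
      (u z - c) * pd1 ϱ z + v z * pd2 ϱ z = 0 ∧
      ϱ z * ((u z - c) * pd1 u z + v z * pd2 u z) = -pd1 P z ∧
      ϱ z * ((u z - c) * pd1 v z + v z * pd2 v z) = -pd2 P z - g * ϱ z := by
  intro ϱ u v P z hz
  have hψz : ContDiffAt ℝ 2 ψ z := hψ.contDiffAt (hΩ.mem_nhds hz)
  have hr : 0 < ρ (-ψ z) := hpos z hz
  have hs : 0 < √(ρ (-ψ z)) := Real.sqrt_pos.mpr hr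
  have hsq : ρ (-ψ z) = √(ρ (-ψ z)) ^ 2 := (Real.sq_sqrt hr.le).symm
  have hnψ := (hψz.differentiableAt (by norm_num)).hasFDerivAt.neg
  have ha := hψz.differentiableAt_pd1.hasFDerivAt
  have hb := hψz.differentiableAt_pd2.hasFDerivAt
  have hρ' := (hρ.differentiable (by norm_num) (-ψ z)).hasDerivAt
  have hB' := (hB.differentiable (by norm_num) (-ψ z)).hasDerivAt
  have hq := ((hρ'.sqrt hr.ne').inv hs.ne').comp_hasFDerivAt z hnψ
  have hϱ : HasFDerivAt ϱ _ z := hρ'.comp_hasFDerivAt z hnψ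
  have hu : HasFDerivAt u _ z := (hb.mul hq).const_add c
  have hv : HasFDerivAt v _ z := ha.neg.mul hq
  have hP : HasFDerivAt P _ z :=
    (((((ha.pow 2).add (hb.pow 2)).mul_const (2⁻¹ : ℝ)).const_sub C₀).sub
      ((hϱ.const_mul g).mul hasFDerivAt_snd)).add (hB'.comp_hasFDerivAt z hnψ)
  have hcomm := hψz.pd1_pd2_comm
  have hY := hYih z hz
  rw [hu.pd1_eq, hu.pd2_eq, hv.pd1_eq, hv.pd2_eq, hϱ.pd1_eq, hϱ.pd2_eq, hP.pd1_eq, hP.pd2_eq]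
  have h1 (f : ℝ × ℝ → ℝ) : fderiv ℝ f z (1, 0) = pd1 f z := rfl
  have h2 (f : ℝ × ℝ → ℝ) : fderiv ℝ f z (0, 1) = pd2 f z := rfl
  simp [u, v, ϱ, h1, h2]
  generalize √(ρ (-ψ z)) = s at hs hsq
  rw [hsq, hcomm]
  refine ⟨?_, ?_, ?_, ?_⟩
  · field_simp
    ring
  · field_simp
    ring
  · field_simp
    linear_combination (-2 * s ^ 2 * pd1 ψ z) * hY
  · field_simp
    linear_combination (-2 * s ^ 2 * pd2 ψ z) * hY
end

section
/- The function ℝ² → ℝ given by (ξ₁, ξ₂) ↦ 1 / (1 + (ξ₁² + ξ₂²)(1 + ξ₁²)) is Lebesgue integrable on ℝ²; that is, ∫_{ℝ²} dξ₁ dξ₂ / (1 + (ξ₁² + ξ₂²)(1 + ξ₁²)) < ∞. -/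
/-- The anisotropic weight `(ξ₁,ξ₂) ↦ 1/(1 + (ξ₁² + ξ₂²)(1 + ξ₁²))` is Lebesgue integrable
on ℝ². -/
theorem anisotropic_weight_integrable :
    MeasureTheory.Integrable
      (fun ξ : ℝ × ℝ => 1 / (1 + (ξ.1 ^ 2 + ξ.2 ^ 2) * (1 + ξ.1 ^ 2)))
      MeasureTheory.volume := by
  have hprod : MeasureTheory.Integrable
      (fun ξ : ℝ × ℝ => (1 + ξ.1 ^ 2)⁻¹ * (1 + ξ.2 ^ 2)⁻¹) MeasureTheory.volume :=
    integrable_inv_one_add_sq.mul_prod integrable_inv_one_add_sq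
  refine hprod.mono' (Measurable.aestronglyMeasurable (by fun_prop)) (.of_forall fun ξ => ?_)
  rw [Real.norm_of_nonneg (by positivity), ← mul_inv, one_div]
  gcongr
  nlinarith [sq_nonneg (ξ.1 ^ 2)]
end

section
/- Anisotropic Sobolev-type inequality: there exists a constant C > 0 such that for every Schwartz function f : ℝ² → ℂ one has ‖f‖_{L^∞(ℝ²)} ≤ C ( ‖f‖_{L²(ℝ²)} + ‖∂₁f‖_{L²(ℝ²)} + ‖∂₂f‖_{L²(ℝ²)} + ‖∂₁∂₁f‖_{L²(ℝ²)} + ‖∂₂∂₁f‖_{L²(ℝ²)} ), where ∂₁, ∂₂ denote the partial derivatives in the first and second coordinates. -/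
open MeasureTheory

open scoped ENNReal LineDeriv SchwartzMap
open Filter Topology

/-- One-dimensional Agmon-type bound: a function vanishing at `-∞` is bounded pointwise by its
`H¹` norm. -/
theorem enorm_sq_le_lintegral_of_tendsto_atBot {g g' : ℝ → ℂ} (hg : ∀ t, HasDerivAt g (g' t) t)
    (hg' : Continuous g') (h0 : Tendsto g atBot (𝓝 0)) (x : ℝ) :
    ‖g x‖ₑ ^ 2 ≤ ∫⁻ t, (‖g t‖ₑ ^ 2 + ‖g' t‖ₑ ^ 2) := by
  have hgc : Continuous g := continuous_iff_continuousAt.2 fun t => (hg t).continuousAt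
  have hderiv (t : ℝ) : HasDerivAt (fun t => ‖g t‖ ^ 2) (2 * inner ℝ (g t) (g' t)) t :=
    (hg t).norm_sq
  have hbound (t : ℝ) : ‖2 * inner ℝ (g t) (g' t)‖ₑ ≤ ‖g t‖ₑ ^ 2 + ‖g' t‖ₑ ^ 2 := by
    have h : ‖2 * inner ℝ (g t) (g' t)‖₊ ≤ ‖g t‖₊ ^ 2 + ‖g' t‖₊ ^ 2 := by
      rw [← NNReal.coe_le_coe]
      push_cast
      rw [norm_mul, Real.norm_ofNat]
      nlinarith [norm_inner_le_norm (𝕜 := ℝ) (g t) (g' t), sq_nonneg (‖g t‖ - ‖g' t‖)]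
    simp only [enorm_eq_nnnorm]
    exact_mod_cast h
  by_cases htop : ∫⁻ t, (‖g t‖ₑ ^ 2 + ‖g' t‖ₑ ^ 2) = ∞
  · simp [htop]
  have hint : Integrable (fun t => 2 * inner ℝ (g t) (g' t)) :=
    ⟨(continuous_const.mul (hgc.inner hg')).aestronglyMeasurable,
      (lintegral_mono hbound).trans_lt (lt_top_iff_ne_top.2 htop)⟩
  have hlim : Tendsto (fun t => ‖g t‖ ^ 2) atBot (𝓝 0) := by
    simpa using h0.norm.pow 2
  have hftc := integral_Iic_of_hasDerivAt_of_tendsto' (a := x) (fun t _ => hderiv t)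
    hint.integrableOn hlim
  calc ‖g x‖ₑ ^ 2 = ‖∫ t in Set.Iic x, 2 * inner ℝ (g t) (g' t)‖ₑ := by
        rw [hftc, sub_zero, enorm_pow, enorm_norm]
    _ ≤ ∫⁻ t in Set.Iic x, ‖2 * inner ℝ (g t) (g' t)‖ₑ := enorm_integral_le_lintegral_enorm _
    _ ≤ ∫⁻ t, ‖2 * inner ℝ (g t) (g' t)‖ₑ := setLIntegral_le_lintegral _ _
    _ ≤ ∫⁻ t, (‖g t‖ₑ ^ 2 + ‖g' t‖ₑ ^ 2) := lintegral_mono hbound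

theorem SchwartzMap.enorm_sq_le_lintegral_line {E : Type*} [NormedAddCommGroup E]
    [NormedSpace ℝ E] [ProperSpace E] (f : 𝓢(E, ℂ)) {c : ℝ → E} {v : E}
    (hc : ∀ t, HasDerivAt c v t) (hc0 : Tendsto c atBot (cocompact E)) (x : ℝ) :
    ‖f (c x)‖ₑ ^ 2 ≤ ∫⁻ t, (‖f (c t)‖ₑ ^ 2 + ‖(∂_{v} f : 𝓢(E, ℂ)) (c t)‖ₑ ^ 2) := by
  refine enorm_sq_le_lintegral_of_tendsto_atBot (g := fun t => f (c t))
    (g' := fun t => (∂_{v} f : 𝓢(E, ℂ)) (c t)) (fun t => ?_) ?_ ?_ x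
  · rw [SchwartzMap.lineDerivOp_apply_eq_fderiv]
    exact (f.hasFDerivAt (c t)).comp_hasDerivAt t (hc t)
  · exact (SchwartzMap.continuous _).comp
      (continuous_iff_continuousAt.2 fun t => (hc t).continuousAt)
  · exact (zero_at_infty f).comp hc0

theorem SchwartzMap.enorm_sq_le_lintegral_prod (f : 𝓢(ℝ × ℝ, ℂ)) (z : ℝ × ℝ) :
    ‖f z‖ₑ ^ 2 ≤ (∫⁻ w, ‖f w‖ₑ ^ 2) + (∫⁻ w, ‖(∂_{((0 : ℝ), (1 : ℝ))} f : 𝓢(ℝ × ℝ, ℂ)) w‖ₑ ^ 2)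
      + ((∫⁻ w, ‖(∂_{((1 : ℝ), (0 : ℝ))} f : 𝓢(ℝ × ℝ, ℂ)) w‖ₑ ^ 2)
      + ∫⁻ w, ‖(∂_{((0 : ℝ), (1 : ℝ))} (∂_{((1 : ℝ), (0 : ℝ))} f) : 𝓢(ℝ × ℝ, ℂ)) w‖ₑ ^ 2) := by
  obtain ⟨x, y⟩ := z
  have hm (g : 𝓢(ℝ × ℝ, ℂ)) : Measurable fun w => ‖g w‖ₑ ^ 2 :=
    g.continuous.measurable.enorm.pow_const 2
  have hhor (g : 𝓢(ℝ × ℝ, ℂ)) : ‖g (x, y)‖ₑ ^ 2 ≤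
      ∫⁻ s, (‖g (s, y)‖ₑ ^ 2 + ‖(∂_{((1 : ℝ), (0 : ℝ))} g : 𝓢(ℝ × ℝ, ℂ)) (s, y)‖ₑ ^ 2) :=
    g.enorm_sq_le_lintegral_line (c := fun s => (s, y))
      (fun s => (hasDerivAt_id s).prodMk (hasDerivAt_const s y))
      (Tendsto.of_tendsto_comp (g := Prod.fst) atBot_le_cocompact
        (comap_cocompact_le continuous_fst)) x
  have hver (g : 𝓢(ℝ × ℝ, ℂ)) (s : ℝ) : ‖g (s, y)‖ₑ ^ 2 ≤
      ∫⁻ t, (‖g (s, t)‖ₑ ^ 2 + ‖(∂_{((0 : ℝ), (1 : ℝ))} g : 𝓢(ℝ × ℝ, ℂ)) (s, t)‖ₑ ^ 2) :=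
    g.enorm_sq_le_lintegral_line (c := fun t => (s, t))
      (fun t => (hasDerivAt_const t s).prodMk (hasDerivAt_id t))
      (Tendsto.of_tendsto_comp (g := Prod.snd) atBot_le_cocompact
        (comap_cocompact_le continuous_snd)) y
  have hslice (g : 𝓢(ℝ × ℝ, ℂ)) : ∫⁻ s, ‖g (s, y)‖ₑ ^ 2 ≤
      (∫⁻ w, ‖g w‖ₑ ^ 2) + ∫⁻ w, ‖(∂_{((0 : ℝ), (1 : ℝ))} g : 𝓢(ℝ × ℝ, ℂ)) w‖ₑ ^ 2 := by
    rw [← lintegral_add_left (hm g), Measure.volume_eq_prod,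
      lintegral_prod]
    · exact lintegral_mono (hver g)
    · exact ((hm g).add (hm _)).aemeasurable
  refine (hhor f).trans ?_
  have hmf : Measurable fun s : ℝ => ‖f (s, y)‖ₑ ^ 2 := (hm f).comp measurable_prodMk_right
  rw [lintegral_add_left hmf]
  exact add_le_add (hslice f) (hslice _)

/-- Anisotropic Sobolev-type inequality: there is a constant `C > 0` such that every Schwartz
function `f : ℝ² → ℂ` satisfies
`‖f‖_{L^∞} ≤ C(‖f‖_{L²} + ‖∂₁f‖_{L²} + ‖∂₂f‖_{L²} + ‖∂₁∂₁f‖_{L²} + ‖∂₂∂₁f‖_{L²})`. -/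
theorem anisotropic_sobolev_inequality :
    ∃ C > (0 : ℝ), ∀ f : SchwartzMap (ℝ × ℝ) ℂ, ∀ z : ℝ × ℝ,
      ‖f z‖ ≤ C *
        ((eLpNorm (⇑f) 2 volume).toReal
          + (eLpNorm (fun w => fderiv ℝ (⇑f) w (1, 0)) 2 volume).toReal
          + (eLpNorm (fun w => fderiv ℝ (⇑f) w (0, 1)) 2 volume).toReal
          + (eLpNorm (fun w => fderiv ℝ (fun y => fderiv ℝ (⇑f) y (1, 0)) w (1, 0)) 2
              volume).toReal
          + (eLpNorm (fun w => fderiv ℝ (fun y => fderiv ℝ (⇑f) y (1, 0)) w (0, 1)) 2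
              volume).toReal) := by
  have heq (g : 𝓢(ℝ × ℝ, ℂ)) :
      ∫⁻ w, ‖g w‖ₑ ^ 2 = ENNReal.ofReal ((eLpNorm (⇑g) 2 volume).toReal ^ 2) := by
    rw [ENNReal.ofReal_pow ENNReal.toReal_nonneg,
      ENNReal.ofReal_toReal (g.memLp 2 volume).eLpNorm_ne_top]
    simpa using (eLpNorm_nnreal_pow_eq_lintegral (p := 2) (f := ⇑g) (μ := volume)
      two_ne_zero).symm
  refine ⟨1, one_pos, fun f z => ?_⟩
  have h := f.enorm_sq_le_lintegral_prod z
  simp only [heq] at h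
  rw [← ofReal_norm, ← ENNReal.ofReal_pow (norm_nonneg _),
    ← ENNReal.ofReal_add (by positivity) (by positivity),
    ← ENNReal.ofReal_add (by positivity) (by positivity),
    ← ENNReal.ofReal_add (by positivity) (by positivity),
    ENNReal.ofReal_le_ofReal_iff (by positivity)] at h
  have h1 (v : ℝ × ℝ) (g : 𝓢(ℝ × ℝ, ℂ)) :
      ⇑(∂_{v} g : 𝓢(ℝ × ℝ, ℂ)) = fun w => fderiv ℝ (⇑g) w v :=
    funext fun w => SchwartzMap.lineDerivOp_apply_eq_fderiv v g w
  simp only [h1] at h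
  rw [one_mul]
  refine le_of_sq_le_sq (h.trans ?_) (by positivity)
  have hn (F : ℝ × ℝ → ℂ) : 0 ≤ (eLpNorm F 2 volume).toReal := ENNReal.toReal_nonneg
  have key {a b c d e : ℝ} (ha : 0 ≤ a) (hb : 0 ≤ b) (hc : 0 ≤ c) (hd : 0 ≤ d) (he : 0 ≤ e) :
      a ^ 2 + c ^ 2 + (b ^ 2 + e ^ 2) ≤ (a + b + c + d + e) ^ 2 := by
    rw [← sub_nonneg]
    ring_nf
    positivity
  exact key (hn _) (hn _) (hn _) (hn _) (hn _)
end

section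
/- Quadratic growth and coercivity of the penalized integrand: there exists s₀ ∈ (0, 2/3) such that for every s ∈ (0, s₀) there exist constants σ₁, σ₂, σ₃, σ₄ > 0 with the following properties for all p = (p₁,p₂) ∈ ℝ²: (σ₁/2)(p₁² + p₂²) ≤ a(p₁,p₂; s) ≤ (σ₂/2)(p₁² + p₂²), and σ₃(p₁² + p₂²) ≤ ∇a(p₁,p₂; s)·(p₁,p₂) ≤ σ₄(p₁² + p₂²). -/
/-- The penalized integrand `a(p₁,p₂; s) = Φ_s(|p|²)f(p) + (1 − Φ_s(|p|²))|p|²/2`, where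
`f(p₁,p₂) = (p₁² + p₂²)/(2(1 + p₂))` and `Φ_s = Φ(·/s)`.  (Division by zero in Lean returns 0,
which implements the convention that the first term is 0 wherever `Φ_s` vanishes.) -/
noncomputable def pen (Φ : ℝ → ℝ) (s : ℝ) (p : ℝ × ℝ) : ℝ :=
  Φ ((p.1 ^ 2 + p.2 ^ 2) / s) * ((p.1 ^ 2 + p.2 ^ 2) / (2 * (1 + p.2)))
    + (1 - Φ ((p.1 ^ 2 + p.2 ^ 2) / s)) * ((p.1 ^ 2 + p.2 ^ 2) / 2)

/-- Euler (radial) derivative of the penalized integrand away from the singular line. -/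
theorem fderiv_pen_apply_self {Φ : ℝ → ℝ} (hΦ : Differentiable ℝ Φ) (s : ℝ) {p : ℝ × ℝ}
    (hp : 1 + p.2 ≠ 0) :
    fderiv ℝ (pen Φ s) p p = (p.1 ^ 2 + p.2 ^ 2) *
      (1 - (Φ ((p.1 ^ 2 + p.2 ^ 2) / s) * (p.2 / (1 + p.2))
        + (p.1 ^ 2 + p.2 ^ 2) / s * deriv Φ ((p.1 ^ 2 + p.2 ^ 2) / s) * (p.2 / (1 + p.2))
        + Φ ((p.1 ^ 2 + p.2 ^ 2) / s) * (p.2 / (1 + p.2) ^ 2) / 2)) := by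
  have h1 : HasFDerivAt (fun x : ℝ × ℝ => x.1) (ContinuousLinearMap.fst ℝ ℝ ℝ) p := hasFDerivAt_fst
  have h2 : HasFDerivAt (fun x : ℝ × ℝ => x.2) (ContinuousLinearMap.snd ℝ ℝ ℝ) p := hasFDerivAt_snd
  have hr := (h1.pow 2).add (h2.pow 2)
  have hφ := (hΦ ((p.1 ^ 2 + p.2 ^ 2) / s)).hasDerivAt.comp_hasFDerivAt p (hr.mul_const s⁻¹)
  have hq := ((h2.const_add 1).const_mul 2)
  have hi := (hasDerivAt_inv (mul_ne_zero two_ne_zero hp)).comp_hasFDerivAt p hq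
  have h := (hφ.mul (hr.mul hi)).add ((hφ.const_sub 1).mul (hr.mul_const 2⁻¹))
  have e : fderiv ℝ (pen Φ s) p = _ := h.fderiv
  rw [e]
  simp [smul_eq_mul, ← div_eq_mul_inv]
  field_simp
  ring

/-- Outside the support of the cutoff the penalized integrand is the Dirichlet integrand. -/
theorem fderiv_pen_apply_self_of_notMem_tsupport {Φ : ℝ → ℝ} {s : ℝ} {p : ℝ × ℝ}
    (hp : (p.1 ^ 2 + p.2 ^ 2) / s ∉ tsupport Φ) :
    fderiv ℝ (pen Φ s) p p = p.1 ^ 2 + p.2 ^ 2 := by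
  have hc : ContinuousAt (fun x : ℝ × ℝ => (x.1 ^ 2 + x.2 ^ 2) / s) p := by fun_prop
  have hev : pen Φ s =ᶠ[nhds p] fun x : ℝ × ℝ => (x.1 ^ 2 + x.2 ^ 2) * 2⁻¹ := by
    filter_upwards [hc.eventually (notMem_tsupport_iff_eventuallyEq.mp hp)] with x hx
    have hx' : Φ ((x.1 ^ 2 + x.2 ^ 2) / s) = 0 := hx
    simp only [pen, hx']
    ring
  have h1 : HasFDerivAt (fun x : ℝ × ℝ => x.1) (ContinuousLinearMap.fst ℝ ℝ ℝ) p := hasFDerivAt_fst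
  have h2 : HasFDerivAt (fun x : ℝ × ℝ => x.2) (ContinuousLinearMap.snd ℝ ℝ ℝ) p := hasFDerivAt_snd
  have e : fderiv ℝ (fun x : ℝ × ℝ => (x.1 ^ 2 + x.2 ^ 2) * 2⁻¹) p = _ :=
    (((h1.pow 2).add (h2.pow 2)).mul_const 2⁻¹).fderiv
  rw [hev.fderiv_eq, e]
  simp
  ring

/-- The function `t ↦ t Φ'(t)` is bounded for a compactly supported `C¹` function `Φ`. -/
theorem exists_abs_mul_deriv_le {Φ : ℝ → ℝ} (hΦ : ContDiff ℝ 1 Φ) (hc : HasCompactSupport Φ) :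
    ∃ B, 0 ≤ B ∧ ∀ t, |t * deriv Φ t| ≤ B := by
  obtain ⟨B, hB⟩ := (hc.deriv.mul_left (f := fun t => t)).exists_bound_of_continuous
    (continuous_id.mul (hΦ.continuous_deriv le_rfl))
  exact ⟨B, (norm_nonneg _).trans (hB 0), hB⟩



/-- Quadratic growth and coercivity of the penalized integrand: there exists `s₀ ∈ (0, 2/3)`
such that for all `s ∈ (0, s₀)` there are `σ₁,σ₂,σ₃,σ₄ > 0` with
`(σ₁/2)|p|² ≤ a(p;s) ≤ (σ₂/2)|p|²` and `σ₃|p|² ≤ ∇a(p;s)·p ≤ σ₄|p|²` for all `p ∈ ℝ²`. -/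
theorem pen_growth_and_coercivity
    (Φ : ℝ → ℝ) (hΦ : ContDiff ℝ (⊤ : ℕ∞) Φ)
    (hΦ01 : ∀ t, Φ t ∈ Set.Icc (0 : ℝ) 1)
    (hΦsupp : tsupport Φ ⊆ Set.Ioo (-(3 / 2) : ℝ) (3 / 2))
    (hΦone : ∀ t ∈ Set.Icc (-1 : ℝ) 1, Φ t = 1) :
    ∃ s₀ ∈ Set.Ioo (0 : ℝ) (2 / 3), ∀ s ∈ Set.Ioo (0 : ℝ) s₀,
      ∃ σ₁ > (0 : ℝ), ∃ σ₂ > (0 : ℝ), ∃ σ₃ > (0 : ℝ), ∃ σ₄ > (0 : ℝ), ∀ p : ℝ × ℝ,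
        σ₁ / 2 * (p.1 ^ 2 + p.2 ^ 2) ≤ pen Φ s p ∧
        pen Φ s p ≤ σ₂ / 2 * (p.1 ^ 2 + p.2 ^ 2) ∧
        σ₃ * (p.1 ^ 2 + p.2 ^ 2) ≤ fderiv ℝ (pen Φ s) p p ∧
        fderiv ℝ (pen Φ s) p p ≤ σ₄ * (p.1 ^ 2 + p.2 ^ 2) := by
  have hcs : HasCompactSupport Φ :=
    isCompact_Icc.of_isClosed_subset (isClosed_tsupport Φ) (hΦsupp.trans Set.Ioo_subset_Icc_self)
  have hdiff : Differentiable ℝ Φ := hΦ.differentiable (by simp)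
  obtain ⟨B, hB0, hB⟩ := exists_abs_mul_deriv_le (hΦ.of_le (by exact_mod_cast le_top)) hcs
  obtain ⟨η, hη⟩ : ∃ η, η = 1 / (4 * (B + 2)) := ⟨_, rfl⟩
  have hη0 : 0 < η := by rw [hη]; positivity
  have hηB : (4 * (B + 2)) * η = 1 := by rw [hη]; field_simp
  have hη8 : η ≤ 1 / 8 := by nlinarith
  refine ⟨η ^ 2 / 2, ⟨by positivity, by nlinarith⟩, ?_⟩
  rintro s ⟨hs0, hs⟩
  refine ⟨1 / 2, by norm_num, 3 / 2, by norm_num, 1 / 2, by norm_num, 3 / 2, by norm_num, ?_⟩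
  intro p
  have hr0 : 0 ≤ p.1 ^ 2 + p.2 ^ 2 := by positivity
  by_cases hp : (p.1 ^ 2 + p.2 ^ 2) / s ∈ tsupport Φ
  · have hlt := (hΦsupp hp).2
    rw [div_lt_iff₀ hs0] at hlt
    have hq : |p.2| ≤ η := abs_le_of_sq_le_sq (by nlinarith [sq_nonneg p.1]) hη0.le
    obtain ⟨hq1, hq2⟩ := abs_le.mp hq
    have hpos : 3 / 4 ≤ 1 + p.2 := by linarith
    have hpos' : 0 < 1 + p.2 := by linarith
    have hu : |p.2 / (1 + p.2)| ≤ 2 * η := by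
      rw [abs_div, abs_of_pos hpos', div_le_iff₀ hpos']
      nlinarith
    have hv : |p.2 / (1 + p.2) ^ 2| ≤ 2 * η := by
      rw [abs_div, abs_of_pos (pow_pos hpos' 2), div_le_iff₀ (pow_pos hpos' 2)]
      nlinarith
    obtain ⟨hφ0, hφ1⟩ := hΦ01 ((p.1 ^ 2 + p.2 ^ 2) / s)
    have hBt := hB ((p.1 ^ 2 + p.2 ^ 2) / s)
    have hpen : pen Φ s p = (p.1 ^ 2 + p.2 ^ 2) / 2 *
        (1 - Φ ((p.1 ^ 2 + p.2 ^ 2) / s) * (p.2 / (1 + p.2))) := by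
      unfold pen
      field_simp
      ring
    rw [hpen, fderiv_pen_apply_self hdiff s hpos'.ne']
    generalize Φ ((p.1 ^ 2 + p.2 ^ 2) / s) = φ at *
    generalize (p.1 ^ 2 + p.2 ^ 2) / s * deriv Φ ((p.1 ^ 2 + p.2 ^ 2) / s) = b at *
    generalize p.2 / (1 + p.2) = u at *
    generalize p.2 / (1 + p.2) ^ 2 = v at *
    generalize p.1 ^ 2 + p.2 ^ 2 = r at *
    have hφ : |φ| ≤ 1 := by rwa [abs_of_nonneg hφ0]
    have h1 : |φ * u| ≤ 1 * (2 * η) := by rw [abs_mul]; gcongr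
    have h2 : |b * u| ≤ B * (2 * η) := by rw [abs_mul]; gcongr
    have h3 : |φ * v| ≤ 1 * (2 * η) := by rw [abs_mul]; gcongr
    rw [abs_le] at h1 h2 h3
    refine ⟨?_, ?_, ?_, ?_⟩ <;> nlinarith
  · have hpen : pen Φ s p = (p.1 ^ 2 + p.2 ^ 2) / 2 := by
      simp [pen, image_eq_zero_of_notMem_tsupport hp]
    rw [hpen, fderiv_pen_apply_self_of_notMem_tsupport hp]
    refine ⟨?_, ?_, ?_, ?_⟩ <;> linarith
end

section
/- Controlled gradient of the penalized integrand: there exists s₀ ∈ (0, 2/3) such that for every s ∈ (0, s₀) there exists σ₅ > 0 with |∇a(p₁,p₂; s)|² ≤ σ₅ · (∇a(p₁,p₂; s)·(p₁,p₂)) for all (p₁,p₂) ∈ ℝ². -/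
theorem hasFDerivAt_sq_add_sq (p : ℝ × ℝ) :
    HasFDerivAt (fun p : ℝ × ℝ => p.1 ^ 2 + p.2 ^ 2)
      ((2 * p.1) • ContinuousLinearMap.fst ℝ ℝ ℝ + (2 * p.2) • ContinuousLinearMap.snd ℝ ℝ ℝ)
      p := by
  have h := ((hasFDerivAt_fst (𝕜 := ℝ) (p := p)).pow 2).add
    ((hasFDerivAt_snd (𝕜 := ℝ) (p := p)).pow 2)
  exact h.congr_fderiv (by ext <;> simp)

/-- The derivative of the penalized integrand outside the support of the cutoff. -/
theorem fderiv_pen_of_notMem_tsupport {Φ : ℝ → ℝ} {s : ℝ} {p : ℝ × ℝ}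
    (hp : (p.1 ^ 2 + p.2 ^ 2) / s ∉ tsupport Φ) (v : ℝ × ℝ) :
    fderiv ℝ (pen Φ s) p v = p.1 * v.1 + p.2 * v.2 := by
  have hcont : Continuous fun z : ℝ × ℝ => (z.1 ^ 2 + z.2 ^ 2) / s := by fun_prop
  have heq : pen Φ s =ᶠ[nhds p] fun z => (1 / 2 : ℝ) * (z.1 ^ 2 + z.2 ^ 2) := by
    filter_upwards [hcont.continuousAt.eventually (notMem_tsupport_iff_eventuallyEq.mp hp)]
      with z hz
    simp only [Pi.zero_apply] at hz
    rw [pen, hz]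
    ring
  rw [heq.fderiv_eq, ((hasFDerivAt_sq_add_sq p).const_mul (1 / 2)).fderiv]
  simp
  ring

/-- The derivative of the penalized integrand away from the pole of `f`. -/
theorem fderiv_pen {Φ : ℝ → ℝ} (hΦ : Differentiable ℝ Φ) {s : ℝ} {p : ℝ × ℝ}
    (hp : 1 + p.2 ≠ 0) (v : ℝ × ℝ) :
    fderiv ℝ (pen Φ s) p v =
      (1 - (Φ ((p.1 ^ 2 + p.2 ^ 2) / s)
          + (p.1 ^ 2 + p.2 ^ 2) / s * deriv Φ ((p.1 ^ 2 + p.2 ^ 2) / s)) * (p.2 / (1 + p.2)))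
          * (p.1 * v.1 + p.2 * v.2)
        - (p.1 ^ 2 + p.2 ^ 2) / 2 * Φ ((p.1 ^ 2 + p.2 ^ 2) / s) / (1 + p.2) ^ 2 * v.2 := by
  have hq := hasFDerivAt_sq_add_sq p
  have hcut := (hΦ ((p.1 ^ 2 + p.2 ^ 2) / s)).hasDerivAt.comp_hasFDerivAt p
    (hq.mul_const s⁻¹)
  have hden := (hasDerivAt_inv hp).comp_hasFDerivAt p
    ((hasFDerivAt_snd (𝕜 := ℝ) (p := p)).const_add 1)
  have h := (hcut.mul ((hq.mul hden).mul_const (1 / 2))).add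
    ((hcut.const_sub 1).mul (hq.mul_const (1 / 2)))
  have hpen : HasFDerivAt (pen Φ s) _ p := h.congr_of_eventuallyEq <| by
    refine .of_forall fun z => ?_
    simp only [pen, Pi.add_apply, Pi.mul_apply, Function.comp_apply, div_eq_mul_inv, mul_inv]
    ring
  rw [hpen.fderiv]
  simp [← div_eq_mul_inv]
  field_simp
  ring

/-- The controlled-gradient inequality for a vector `A (x, y) - (0, B)` that is close to `(x, y)`. -/
theorem controlled_of_bounds {x y A B : ℝ} (hq : x ^ 2 + y ^ 2 ≤ 1) (hy : |y| ≤ 1 / 8)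
    (hA : 3 / 4 ≤ A) (hA' : A ≤ 5 / 4) (hB : 0 ≤ B) (hB' : B ≤ 2 * (x ^ 2 + y ^ 2)) :
    (A * x) ^ 2 + (A * y - B) ^ 2 ≤ 20 * (A * (x ^ 2 + y ^ 2) - B * y) := by
  obtain ⟨h1, h2⟩ := abs_le.mp hy
  have hq0 : 0 ≤ x ^ 2 + y ^ 2 := by positivity
  have hBB : B ^ 2 ≤ 4 * (x ^ 2 + y ^ 2) := by nlinarith
  have hBy : B * y ≤ (x ^ 2 + y ^ 2) / 4 := by nlinarith
  have hBy' : -((x ^ 2 + y ^ 2) / 4) ≤ B * y := by nlinarith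
  have hAA : A ^ 2 ≤ 25 / 16 := by nlinarith
  have e1 : A ^ 2 * (x ^ 2 + y ^ 2) ≤ 25 / 16 * (x ^ 2 + y ^ 2) := by gcongr
  have e2 : 3 / 4 * (x ^ 2 + y ^ 2) ≤ A * (x ^ 2 + y ^ 2) := by gcongr
  have e3 : A * -(B * y) ≤ 5 / 4 * ((x ^ 2 + y ^ 2) / 4) := by nlinarith
  nlinarith


/-- Controlled gradient of the penalized integrand: there exists `s₀ ∈ (0, 2/3)` such that for
all `s ∈ (0, s₀)` there is `σ₅ > 0` with `|∇a(p;s)|² ≤ σ₅ ∇a(p;s)·p` for all `p ∈ ℝ²`. -/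
theorem pen_gradient_controlled
    (Φ : ℝ → ℝ) (hΦ : ContDiff ℝ (⊤ : ℕ∞) Φ)
    (hΦ01 : ∀ t, Φ t ∈ Set.Icc (0 : ℝ) 1)
    (hΦsupp : tsupport Φ ⊆ Set.Ioo (-(3 / 2) : ℝ) (3 / 2))
    (hΦone : ∀ t ∈ Set.Icc (-1 : ℝ) 1, Φ t = 1) :
    ∃ s₀ ∈ Set.Ioo (0 : ℝ) (2 / 3), ∀ s ∈ Set.Ioo (0 : ℝ) s₀,
      ∃ σ₅ > (0 : ℝ), ∀ p : ℝ × ℝ,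
        (fderiv ℝ (pen Φ s) p (1, 0)) ^ 2 + (fderiv ℝ (pen Φ s) p (0, 1)) ^ 2
          ≤ σ₅ * fderiv ℝ (pen Φ s) p p := by
  have hdiff : Differentiable ℝ Φ := hΦ.differentiable (by simp)
  have hcomp : HasCompactSupport Φ :=
    isCompact_Icc.of_isClosed_subset (isClosed_tsupport Φ)
      (hΦsupp.trans Set.Ioo_subset_Icc_self)
  obtain ⟨M, hM⟩ := hcomp.deriv.exists_bound_of_continuous (hΦ.continuous_deriv (by simp))
  have hM0 : 0 ≤ M := (norm_nonneg _).trans (hM 0)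
  set δ : ℝ := 1 / (8 + 12 * M) with hδ
  have hδ0 : 0 < δ := by positivity
  have hδM : δ * (8 + 12 * M) = 1 := by rw [hδ]; field_simp
  have hδ8 : δ ≤ 1 / 8 := by nlinarith
  refine ⟨δ ^ 2 / 2, ⟨by positivity, by nlinarith⟩, fun s ⟨hs0, hs⟩ => ⟨20, by norm_num, ?_⟩⟩
  rintro ⟨x, y⟩
  by_cases hp : (x ^ 2 + y ^ 2) / s ∈ tsupport Φ
  · set t := (x ^ 2 + y ^ 2) / s with ht
    have ht0 : 0 ≤ t := by positivity
    have ht1 : t < 3 / 2 := (hΦsupp hp).2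
    have hqt : x ^ 2 + y ^ 2 = t * s := by rw [ht]; field_simp
    have hqδ : x ^ 2 + y ^ 2 ≤ δ ^ 2 := by rw [hqt]; nlinarith
    have hy : |y| ≤ δ := abs_le_of_sq_le_sq (by nlinarith [sq_nonneg x]) hδ0.le
    have hy8 : |y| ≤ 1 / 8 := hy.trans hδ8
    have h1y : 7 / 8 ≤ 1 + y := by linarith [(abs_le.mp hy8).1]
    have hg : |y / (1 + y)| ≤ 2 * δ := by
      rw [abs_div, abs_of_pos (by linarith : 0 < 1 + y), div_le_iff₀ (by linarith)]
      nlinarith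
    obtain ⟨hφ0, hφ1⟩ := hΦ01 t
    have hc : |Φ t + t * deriv Φ t| ≤ 1 + 3 / 2 * M := by
      refine (abs_add_le _ _).trans (add_le_add (by rwa [abs_of_nonneg hφ0]) ?_)
      rw [abs_mul, abs_of_nonneg ht0]
      exact mul_le_mul ht1.le (hM t) (abs_nonneg _) (by norm_num)
    have hcg : |(Φ t + t * deriv Φ t) * (y / (1 + y))| ≤ 1 / 4 := by
      rw [abs_mul]
      refine (mul_le_mul hc hg (abs_nonneg _) (by positivity)).trans ?_
      linarith
    obtain ⟨hcg1, hcg2⟩ := abs_le.mp hcg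
    have hB : (x ^ 2 + y ^ 2) / 2 * Φ t / (1 + y) ^ 2 ≤ 2 * (x ^ 2 + y ^ 2) := by
      rw [div_le_iff₀ (by positivity)]
      have hsq : 1 / 2 ≤ (1 + y) ^ 2 := by nlinarith
      have hq0 : 0 ≤ x ^ 2 + y ^ 2 := by positivity
      nlinarith [mul_le_mul_of_nonneg_left hφ1 hq0, mul_le_mul_of_nonneg_left hsq hq0]
    have hne : 1 + y ≠ 0 := by linarith
    simp only [fderiv_pen (s := s) (p := (x, y)) hdiff hne, ← ht]
    have key := controlled_of_bounds (x := x) (y := y)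
      (A := 1 - (Φ t + t * deriv Φ t) * (y / (1 + y)))
      (B := (x ^ 2 + y ^ 2) / 2 * Φ t / (1 + y) ^ 2)
      (by nlinarith) hy8 (by linarith) (by linarith) (by positivity) hB
    convert key using 1 <;> ring
  · simp only [fderiv_pen_of_notMem_tsupport (p := (x, y)) hp]
    nlinarith [sq_nonneg x, sq_nonneg y]
end

section
/- Uniform ellipticity of the penalized problem: there exists s₀ ∈ (0, 2/3) such that for every s ∈ (0, s₀) there exists ν > 0 with ∑_{i,j=1}^{2} ∂ᵢ∂ⱼa(p₁,p₂; s) qᵢ qⱼ ≥ ν (q₁² + q₂²) for all (p₁,p₂) ∈ ℝ² and all (q₁,q₂) ∈ ℝ²; i.e., the Hessian of a(·; s) is uniformly positive definite on all of ℝ². -/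
open Filter Topology ContinuousLinearMap

/-- `f` is differentiable at `p` with partial derivatives `a` and `b`. -/
def HasPartialsAt (f : ℝ × ℝ → ℝ) (a b : ℝ) (p : ℝ × ℝ) : Prop :=
  HasFDerivAt f (a • fst ℝ ℝ ℝ + b • snd ℝ ℝ ℝ) p

namespace HasPartialsAt

variable {f g : ℝ × ℝ → ℝ} {a b c d a' b' : ℝ} {p : ℝ × ℝ}

theorem fderiv_fst (h : HasPartialsAt f a b p) : fderiv ℝ f p (1, 0) = a := by
  rw [HasFDerivAt.fderiv h]; simp

theorem fderiv_snd (h : HasPartialsAt f a b p) : fderiv ℝ f p (0, 1) = b := by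
  rw [HasFDerivAt.fderiv h]; simp

theorem congr_partials (h : HasPartialsAt f a b p) (ha : a = a') (hb : b = b') :
    HasPartialsAt f a' b' p := by
  subst ha hb; exact h

theorem congr_of_eventuallyEq (h : HasPartialsAt f a b p) (hfg : g =ᶠ[𝓝 p] f) :
    HasPartialsAt g a b p :=
  HasFDerivAt.congr_of_eventuallyEq h hfg

theorem add (hf : HasPartialsAt f a b p) (hg : HasPartialsAt g c d p) :
    HasPartialsAt (fun r => f r + g r) (a + c) (b + d) p := by
  refine (HasFDerivAt.add hf hg).congr_fderiv ?_
  ext <;> simp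

theorem sub (hf : HasPartialsAt f a b p) (hg : HasPartialsAt g c d p) :
    HasPartialsAt (fun r => f r - g r) (a - c) (b - d) p := by
  refine (HasFDerivAt.sub hf hg).congr_fderiv ?_
  ext <;> simp

theorem mul (hf : HasPartialsAt f a b p) (hg : HasPartialsAt g c d p) :
    HasPartialsAt (fun r => f r * g r) (f p * c + g p * a) (f p * d + g p * b) p := by
  refine (HasFDerivAt.mul hf hg).congr_fderiv ?_
  ext <;> simp

theorem const (k : ℝ) : HasPartialsAt (fun _ => k) 0 0 p := by
  refine (hasFDerivAt_const k p).congr_fderiv ?_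
  simp

theorem coord_fst : HasPartialsAt (fun r => r.1) 1 0 p := by
  refine hasFDerivAt_fst.congr_fderiv ?_
  ext <;> simp

theorem coord_snd : HasPartialsAt (fun r => r.2) 0 1 p := by
  refine hasFDerivAt_snd.congr_fderiv ?_
  ext <;> simp

theorem comp {k : ℝ → ℝ} {k' : ℝ} (hk : HasDerivAt k k' (f p)) (hf : HasPartialsAt f a b p) :
    HasPartialsAt (fun r => k (f r)) (k' * a) (k' * b) p := by
  refine (hk.comp_hasFDerivAt p hf).congr_fderiv ?_
  ext <;> simp

theorem normSq : HasPartialsAt (fun r => r.1 ^ 2 + r.2 ^ 2) (2 * p.1) (2 * p.2) p :=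
  (((coord_fst.mul coord_fst).add (coord_snd.mul coord_snd)).congr_of_eventuallyEq
    (.of_forall fun r => by simp only; ring)).congr_partials (by ring) (by ring)

theorem radial {k : ℝ → ℝ} {k' s : ℝ} (hk : HasDerivAt k k' ((p.1 ^ 2 + p.2 ^ 2) / s)) :
    HasPartialsAt (fun r => k ((r.1 ^ 2 + r.2 ^ 2) / s)) (k' * (2 * p.1 / s))
      (k' * (2 * p.2 / s)) p := by
  have h : HasPartialsAt (fun r => (r.1 ^ 2 + r.2 ^ 2) / s) (2 * p.1 / s) (2 * p.2 / s) p :=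
    ((normSq.mul (const s⁻¹)).congr_of_eventuallyEq
      (.of_forall fun r => by simp only [div_eq_mul_inv])).congr_partials (by ring) (by ring)
  exact h.comp hk

theorem vertical {k : ℝ → ℝ} {k' : ℝ} (hk : HasDerivAt k k' p.2) :
    HasPartialsAt (fun r => k r.2) 0 k' p :=
  (coord_snd.comp hk).congr_partials (by ring) (by ring)

end HasPartialsAt

/-- The Hessian quadratic form of a function with Hessian within `1/4` of the identity, entrywise,
is bounded below by `1/2`. -/
theorem hessian_form_ge_of_partials {f a b : ℝ × ℝ → ℝ} {p : ℝ × ℝ} {xx xy yy : ℝ}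
    (hf : ∀ᶠ r in 𝓝 p, HasPartialsAt f (a r) (b r) r)
    (ha : HasPartialsAt a (1 - xx) (-xy) p) (hb : HasPartialsAt b (-xy) (1 - yy) p)
    (hxx : |xx| ≤ 1 / 4) (hxy : |xy| ≤ 1 / 4) (hyy : |yy| ≤ 1 / 4) (q : ℝ × ℝ) :
    fderiv ℝ (fun r => fderiv ℝ f r (1, 0)) p (1, 0) * q.1 * q.1
      + fderiv ℝ (fun r => fderiv ℝ f r (0, 1)) p (1, 0) * q.1 * q.2
      + fderiv ℝ (fun r => fderiv ℝ f r (1, 0)) p (0, 1) * q.2 * q.1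
      + fderiv ℝ (fun r => fderiv ℝ f r (0, 1)) p (0, 1) * q.2 * q.2
    ≥ 1 / 2 * (q.1 ^ 2 + q.2 ^ 2) := by
  have h1 : HasPartialsAt (fun r => fderiv ℝ f r (1, 0)) (1 - xx) (-xy) p :=
    ha.congr_of_eventuallyEq (hf.mono fun r hr => hr.fderiv_fst)
  have h2 : HasPartialsAt (fun r => fderiv ℝ f r (0, 1)) (-xy) (1 - yy) p :=
    hb.congr_of_eventuallyEq (hf.mono fun r hr => hr.fderiv_snd)
  rw [h1.fderiv_fst, h1.fderiv_snd, h2.fderiv_fst, h2.fderiv_snd]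
  rw [abs_le] at hxx hxy hyy
  nlinarith [mul_nonneg (sub_nonneg.2 hxx.2) (sq_nonneg q.1),
    mul_nonneg (sub_nonneg.2 hyy.2) (sq_nonneg q.2),
    mul_nonneg (sub_nonneg.2 hxy.2) (sq_nonneg (q.1 + q.2)),
    mul_nonneg (neg_le_iff_add_nonneg.1 hxy.1) (sq_nonneg (q.1 - q.2))]

/-- A smooth compactly supported function on the line has bounded derivatives up to order
two. -/
theorem exists_deriv_bounds {A : ℝ → ℝ} (hA : ContDiff ℝ (⊤ : ℕ∞) A) (hc : HasCompactSupport A) :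
    ∃ (A₁ A₂ : ℝ → ℝ) (M : ℝ), 0 < M ∧ (∀ t, HasDerivAt A (A₁ t) t) ∧
      (∀ t, HasDerivAt A₁ (A₂ t) t) ∧ (∀ t, |A t| ≤ M) ∧ (∀ t, |A₁ t| ≤ M) ∧ ∀ t, |A₂ t| ≤ M := by
  have hA₁ : ContDiff ℝ (⊤ : ℕ∞) (deriv A) := (contDiff_infty_iff_deriv.1 hA).2
  have hA₂ : ContDiff ℝ (⊤ : ℕ∞) (deriv (deriv A)) := (contDiff_infty_iff_deriv.1 hA₁).2
  obtain ⟨M₀, h₀⟩ := hc.exists_bound_of_continuous hA.continuous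
  obtain ⟨M₁, h₁⟩ := hc.deriv.exists_bound_of_continuous hA₁.continuous
  obtain ⟨M₂, h₂⟩ := hc.deriv.deriv.exists_bound_of_continuous hA₂.continuous
  have n₀ := (norm_nonneg _).trans (h₀ 0)
  have n₁ := (norm_nonneg _).trans (h₁ 0)
  have n₂ := (norm_nonneg _).trans (h₂ 0)
  refine ⟨deriv A, deriv (deriv A), M₀ + M₁ + M₂ + 1, by linarith,
    fun t => ((contDiff_infty_iff_deriv.1 hA).1 t).hasDerivAt,
    fun t => ((contDiff_infty_iff_deriv.1 hA₁).1 t).hasDerivAt,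
    fun t => (h₀ t).trans (by linarith), fun t => (h₁ t).trans (by linarith),
    fun t => (h₂ t).trans (by linarith)⟩

theorem pen_eq {Φ : ℝ → ℝ} {s : ℝ} (hs : s ≠ 0) {p : ℝ × ℝ} (hp : 1 + p.2 ≠ 0) :
    pen Φ s p = 1 / 2 * (p.1 ^ 2 + p.2 ^ 2) -
      s * (Φ ((p.1 ^ 2 + p.2 ^ 2) / s) * ((p.1 ^ 2 + p.2 ^ 2) / s) / 2) * (1 - (1 + p.2)⁻¹) := by
  unfold pen
  field_simp
  ring

section Formula

variable {A A₁ A₂ : ℝ → ℝ} {s : ℝ} {p : ℝ × ℝ}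

theorem hasDerivAt_one_sub_inv {y : ℝ} (hy : 1 + y ≠ 0) :
    HasDerivAt (fun y : ℝ => 1 - (1 + y)⁻¹) (((1 + y)⁻¹) ^ 2) y := by
  have := (((hasDerivAt_id y).const_add 1).inv hy).const_sub 1
  refine this.congr_deriv ?_
  simp only [id]
  field_simp

theorem hasDerivAt_inv_sq {y : ℝ} (hy : 1 + y ≠ 0) :
    HasDerivAt (fun y : ℝ => ((1 + y)⁻¹) ^ 2) (-2 * ((1 + y)⁻¹) ^ 3) y := by
  have := (((hasDerivAt_id y).const_add 1).inv hy).pow 2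
  refine this.congr_deriv ?_
  simp only [id, Pi.inv_apply, Nat.cast_ofNat, Nat.add_one_sub_one, pow_one]
  field_simp

theorem hasPartialsAt_profile (hA : ∀ t, HasDerivAt A (A₁ t) t) (hs : s ≠ 0) (hp : 1 + p.2 ≠ 0) :
    HasPartialsAt
      (fun r => 1 / 2 * (r.1 ^ 2 + r.2 ^ 2) - s * A ((r.1 ^ 2 + r.2 ^ 2) / s) * (1 - (1 + r.2)⁻¹))
      (p.1 - 2 * p.1 * A₁ ((p.1 ^ 2 + p.2 ^ 2) / s) * (1 - (1 + p.2)⁻¹))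
      (p.2 - (2 * p.2 * A₁ ((p.1 ^ 2 + p.2 ^ 2) / s) * (1 - (1 + p.2)⁻¹)
        + s * A ((p.1 ^ 2 + p.2 ^ 2) / s) * ((1 + p.2)⁻¹) ^ 2)) p := by
  refine ((HasPartialsAt.const (1 / 2)).mul .normSq |>.sub
    (((HasPartialsAt.const s).mul (.radial (hA _))).mul
      (.vertical (hasDerivAt_one_sub_inv hp)))).congr_partials ?_ ?_ <;> field_simp <;> ring

theorem hasPartialsAt_profile_fst (hA₁ : ∀ t, HasDerivAt A₁ (A₂ t) t) (hs : s ≠ 0)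
    (hp : 1 + p.2 ≠ 0) :
    HasPartialsAt
      (fun r => r.1 - 2 * r.1 * A₁ ((r.1 ^ 2 + r.2 ^ 2) / s) * (1 - (1 + r.2)⁻¹))
      (1 - (2 * A₁ ((p.1 ^ 2 + p.2 ^ 2) / s) * (1 - (1 + p.2)⁻¹)
        + 4 * (p.1 * p.1 / s) * A₂ ((p.1 ^ 2 + p.2 ^ 2) / s) * (1 - (1 + p.2)⁻¹)))
      (-(4 * (p.1 * p.2 / s) * A₂ ((p.1 ^ 2 + p.2 ^ 2) / s) * (1 - (1 + p.2)⁻¹)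
        + 2 * p.1 * A₁ ((p.1 ^ 2 + p.2 ^ 2) / s) * ((1 + p.2)⁻¹) ^ 2)) p := by
  refine (HasPartialsAt.coord_fst.sub
    ((((HasPartialsAt.const 2).mul .coord_fst).mul (.radial (hA₁ _))).mul
      (.vertical (hasDerivAt_one_sub_inv hp)))).congr_partials ?_ ?_ <;> field_simp <;> ring

theorem hasPartialsAt_profile_snd (hA : ∀ t, HasDerivAt A (A₁ t) t)
    (hA₁ : ∀ t, HasDerivAt A₁ (A₂ t) t) (hs : s ≠ 0) (hp : 1 + p.2 ≠ 0) :
    HasPartialsAt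
      (fun r => r.2 - (2 * r.2 * A₁ ((r.1 ^ 2 + r.2 ^ 2) / s) * (1 - (1 + r.2)⁻¹)
        + s * A ((r.1 ^ 2 + r.2 ^ 2) / s) * ((1 + r.2)⁻¹) ^ 2))
      (-(4 * (p.1 * p.2 / s) * A₂ ((p.1 ^ 2 + p.2 ^ 2) / s) * (1 - (1 + p.2)⁻¹)
        + 2 * p.1 * A₁ ((p.1 ^ 2 + p.2 ^ 2) / s) * ((1 + p.2)⁻¹) ^ 2))
      (1 - (2 * A₁ ((p.1 ^ 2 + p.2 ^ 2) / s) * (1 - (1 + p.2)⁻¹)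
        + 4 * (p.2 * p.2 / s) * A₂ ((p.1 ^ 2 + p.2 ^ 2) / s) * (1 - (1 + p.2)⁻¹)
        + 4 * p.2 * A₁ ((p.1 ^ 2 + p.2 ^ 2) / s) * ((1 + p.2)⁻¹) ^ 2
        + s * A ((p.1 ^ 2 + p.2 ^ 2) / s) * (-2 * ((1 + p.2)⁻¹) ^ 3))) p := by
  refine (HasPartialsAt.coord_snd.sub
    (((((HasPartialsAt.const 2).mul .coord_snd).mul (.radial (hA₁ _))).mul
      (.vertical (hasDerivAt_one_sub_inv hp))).add
      (((HasPartialsAt.const s).mul (.radial (hA _))).mul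
        (.vertical (hasDerivAt_inv_sq hp))))).congr_partials ?_ ?_ <;> field_simp <;> ring

end Formula

/-- Entrywise smallness of the Hessian of the perturbation, with `u`, `v`, `w` standing for the
values of the profile and its derivatives and `δ` for a bound on the gradient variable. -/
theorem perturbation_entries_le {x y s δ M u v w : ℝ} (hs : 0 < s) (hδ : 0 < δ) (hM : 0 < M)
    (hδ1 : δ ≤ 1 / 2) (hδM : 160 * M * δ ≤ 1) (hx : |x| ≤ δ) (hy : |y| ≤ δ)
    (hxy : x ^ 2 + y ^ 2 ≤ 3 / 2 * s) (hsδ : s ≤ δ ^ 2)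
    (hu : |u| ≤ M) (hv : |v| ≤ M) (hw : |w| ≤ M) :
    |2 * v * (1 - (1 + y)⁻¹) + 4 * (x * x / s) * w * (1 - (1 + y)⁻¹)| ≤ 1 / 4 ∧
    |4 * (x * y / s) * w * (1 - (1 + y)⁻¹) + 2 * x * v * ((1 + y)⁻¹) ^ 2| ≤ 1 / 4 ∧
    |2 * v * (1 - (1 + y)⁻¹) + 4 * (y * y / s) * w * (1 - (1 + y)⁻¹)
      + 4 * y * v * ((1 + y)⁻¹) ^ 2 + s * u * (-2 * ((1 + y)⁻¹) ^ 3)| ≤ 1 / 4 := by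
  have hy2 := abs_le.1 hy
  have hpos : 0 < 1 + y := by linarith
  have hinv : |(1 + y)⁻¹| ≤ 2 := by
    rw [abs_of_pos (inv_pos.2 hpos), inv_le_comm₀ hpos two_pos]; linarith
  have hh : |1 - (1 + y)⁻¹| ≤ 2 * δ := by
    have : 1 - (1 + y)⁻¹ = y * (1 + y)⁻¹ := by field_simp; ring
    rw [this, abs_mul, mul_comm 2]
    gcongr
  have quot : ∀ z : ℝ, |z| ≤ 3 / 2 * s → |z / s| ≤ 3 / 2 := fun z hz => by
    rwa [abs_div, abs_of_pos hs, div_le_iff₀ hs]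
  have hxx : |x * x / s| ≤ 3 / 2 := quot _ (abs_le.2 ⟨by nlinarith, by nlinarith⟩)
  have hyy : |y * y / s| ≤ 3 / 2 := quot _ (abs_le.2 ⟨by nlinarith, by nlinarith⟩)
  have hxy : |x * y / s| ≤ 3 / 2 := quot _ (abs_le.2
    ⟨by nlinarith [sq_nonneg (x + y)], by nlinarith [sq_nonneg (x - y)]⟩)
  have e1 : |2 * v * (1 - (1 + y)⁻¹)| ≤ 2 * M * (2 * δ) := by
    rw [abs_mul, abs_mul, abs_two]; gcongr
  have e2 : ∀ z : ℝ, |z| ≤ 3 / 2 →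
      |4 * z * w * (1 - (1 + y)⁻¹)| ≤ 4 * (3 / 2) * M * (2 * δ) := fun z hz => by
    rw [abs_mul, abs_mul, abs_mul, abs_of_pos (four_pos : (0 : ℝ) < 4)]; gcongr
  have e3 : |2 * x * v * ((1 + y)⁻¹) ^ 2| ≤ 2 * δ * M * 2 ^ 2 := by
    rw [abs_mul, abs_mul, abs_mul, abs_two, abs_pow]; gcongr
  have e4 : |4 * y * v * ((1 + y)⁻¹) ^ 2| ≤ 4 * δ * M * 2 ^ 2 := by
    rw [abs_mul, abs_mul, abs_mul, abs_of_pos (four_pos : (0 : ℝ) < 4), abs_pow]; gcongr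
  have e5 : |s * u * (-2 * ((1 + y)⁻¹) ^ 3)| ≤ δ ^ 2 * M * (2 * 2 ^ 3) := by
    rw [abs_mul, abs_mul, abs_mul, abs_of_pos hs, abs_neg, abs_two, abs_pow]; gcongr
  have hδ2 : δ ^ 2 * M ≤ 1 / 2 * (M * δ) := by nlinarith [mul_pos hM hδ]
  refine ⟨(abs_add_le _ _).trans ?_, (abs_add_le _ _).trans ?_, (abs_add_le _ _).trans ?_⟩
  · linarith [e2 _ hxx]
  · linarith [e2 _ hxy]
  · linarith [abs_add_le (2 * v * (1 - (1 + y)⁻¹) + 4 * (y * y / s) * w * (1 - (1 + y)⁻¹))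
      (4 * y * v * ((1 + y)⁻¹) ^ 2), abs_add_le (2 * v * (1 - (1 + y)⁻¹))
      (4 * (y * y / s) * w * (1 - (1 + y)⁻¹)), e2 _ hyy]

/-- Uniform ellipticity of the penalized problem: there exists `s₀ ∈ (0, 2/3)` such that for
every `s ∈ (0, s₀)` there is `ν > 0` with
`∑_{i,j} ∂ᵢ∂ⱼa(p;s) qᵢqⱼ ≥ ν(q₁² + q₂²)` for all `p, q ∈ ℝ²`. -/
theorem pen_uniformly_elliptic
    (Φ : ℝ → ℝ) (hΦ : ContDiff ℝ (⊤ : ℕ∞) Φ)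
    (hΦ01 : ∀ t, Φ t ∈ Set.Icc (0 : ℝ) 1)
    (hΦsupp : tsupport Φ ⊆ Set.Ioo (-(3 / 2) : ℝ) (3 / 2))
    (hΦone : ∀ t ∈ Set.Icc (-1 : ℝ) 1, Φ t = 1) :
    ∃ s₀ ∈ Set.Ioo (0 : ℝ) (2 / 3), ∀ s ∈ Set.Ioo (0 : ℝ) s₀,
      ∃ ν > (0 : ℝ), ∀ p q : ℝ × ℝ,
        fderiv ℝ (fun r => fderiv ℝ (pen Φ s) r (1, 0)) p (1, 0) * q.1 * q.1
          + fderiv ℝ (fun r => fderiv ℝ (pen Φ s) r (0, 1)) p (1, 0) * q.1 * q.2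
          + fderiv ℝ (fun r => fderiv ℝ (pen Φ s) r (1, 0)) p (0, 1) * q.2 * q.1
          + fderiv ℝ (fun r => fderiv ℝ (pen Φ s) r (0, 1)) p (0, 1) * q.2 * q.2
        ≥ ν * (q.1 ^ 2 + q.2 ^ 2) := by
  have hΦzero : ∀ t, 3 / 2 < t → Φ t = 0 := fun t ht =>
    image_eq_zero_of_notMem_tsupport fun h => by linarith [(hΦsupp h).2]
  set A : ℝ → ℝ := fun t => Φ t * t / 2 with hAdef
  have hA : ContDiff ℝ (⊤ : ℕ∞) A := (hΦ.mul contDiff_id).div_const 2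
  have hAsupp : tsupport A ⊆ tsupport Φ :=
    closure_mono fun t ht h => ht (by simp [hAdef, h])
  have hc : HasCompactSupport A :=
    (isCompact_Icc.of_isClosed_subset (isClosed_tsupport A)
      ((hAsupp.trans hΦsupp).trans Set.Ioo_subset_Icc_self))
  obtain ⟨A₁, A₂, M, hM, hd, hd₁, hb, hb₁, hb₂⟩ := exists_deriv_bounds hA hc
  set δ : ℝ := 1 / (160 * (M + 1)) with hδdef
  have hδ : 0 < δ := by positivity
  have hδM : 160 * (M + 1) * δ = 1 := by rw [hδdef]; field_simp
  have hδ1 : δ ≤ 1 / 2 := by nlinarith [mul_pos hM hδ]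
  refine ⟨2 / 3 * δ ^ 2, ⟨by positivity, by nlinarith⟩, fun s hs => ⟨1 / 2, by norm_num, ?_⟩⟩
  obtain ⟨hs0, hsδ⟩ := hs
  intro p
  have hcont : Continuous fun r : ℝ × ℝ => r.1 ^ 2 + r.2 ^ 2 := by fun_prop
  rcases le_or_gt (p.1 ^ 2 + p.2 ^ 2) (3 / 2 * s) with hp | hp
  · have hx : |p.1| ≤ δ := abs_le_of_sq_le_sq (by nlinarith) hδ.le
    have hy : |p.2| ≤ δ := abs_le_of_sq_le_sq (by nlinarith) hδ.le
    have hpos : 0 < 1 + p.2 := by linarith [(abs_le.1 hy).1]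
    obtain ⟨h1, h2, h3⟩ := perturbation_entries_le hs0 hδ hM hδ1 (by nlinarith) hx hy hp
      (by nlinarith) (hb ((p.1 ^ 2 + p.2 ^ 2) / s)) (hb₁ ((p.1 ^ 2 + p.2 ^ 2) / s))
      (hb₂ ((p.1 ^ 2 + p.2 ^ 2) / s))
    have hU : ∀ᶠ r : ℝ × ℝ in 𝓝 p, 0 < 1 + r.2 :=
      (by fun_prop : Continuous fun r : ℝ × ℝ => 1 + r.2).continuousAt.eventually_const_lt hpos
    refine hessian_form_ge_of_partials ?_ (hasPartialsAt_profile_fst hd₁ hs0.ne' hpos.ne')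
      (hasPartialsAt_profile_snd hd hd₁ hs0.ne' hpos.ne') h1 h2 h3
    filter_upwards [hU.eventually_nhds] with r hr
    exact (hasPartialsAt_profile hd hs0.ne' hr.self_of_nhds.ne').congr_of_eventuallyEq
      (hr.mono fun r' hr' => pen_eq hs0.ne' hr'.ne')
  · have hU : ∀ᶠ r : ℝ × ℝ in 𝓝 p, 3 / 2 * s < r.1 ^ 2 + r.2 ^ 2 :=
      hcont.continuousAt.eventually_const_lt hp
    refine hessian_form_ge_of_partials (a := fun r => r.1) (b := fun r => r.2)
      (xx := 0) (xy := 0) (yy := 0) ?_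
      (HasPartialsAt.coord_fst.congr_partials (by simp) (by simp))
      (HasPartialsAt.coord_snd.congr_partials (by simp) (by simp))
      (by simp) (by simp) (by simp)
    filter_upwards [hU.eventually_nhds] with r hr
    refine (((HasPartialsAt.const (1 / 2)).mul .normSq).congr_of_eventuallyEq
      (hr.mono fun r' hr' => ?_)).congr_partials (by ring) (by ring)
    simp only [pen, hΦzero _ ((lt_div_iff₀ hs0).2 hr')]
    ring
end

section
/- Small-s asymptotics of the penalized integrand: for every ε > 0 there exists s₀ ∈ (0, 2/3) such that for all s ∈ (0, s₀) and all p = (p₁,p₂), q = (q₁,q₂) ∈ ℝ²: (i) ((1−ε)/2)|p|² ≤ a(p; s) ≤ ((1+ε)/2)|p|²; (ii) (1−ε)|p|² ≤ ∇a(p; s)·p ≤ (1+ε)|p|²; (iii) ∑_{i,j} ∂ᵢ∂ⱼa(p; s) qᵢqⱼ ≥ (1−ε)|q|²; and (iv) |∇(∂₂a)(p; s) − (0,1)| ≤ ε. In other words, as s → 0 the coercivity and ellipticity constants of a all tend to 1, and ∇∂₂a tends to (0,1) uniformly in p. -/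
/-- Outside `tsupport A`, the composition `A ∘ (|·|² / s)` vanishes near the point; where
`1 + p₂ ≠ 0` the factor `k` is differentiable.  For `s < 2/3` one of the two always applies. -/
lemma hasFDerivAt_radial_mul {A k k' : ℝ → ℝ} {s : ℝ} (hA : Differentiable ℝ A)
    (hsupp : tsupport A ⊆ Set.Ioo (-(3 / 2) : ℝ) (3 / 2))
    (hk : ∀ y, 1 + y ≠ 0 → HasDerivAt k (k' y) y) (hs : 0 < s) (hs' : s < 2 / 3) (p : ℝ × ℝ) :
    HasFDerivAt (fun r : ℝ × ℝ => A ((r.1 ^ 2 + r.2 ^ 2) / s) * k r.2)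
      ((deriv A ((p.1 ^ 2 + p.2 ^ 2) / s) * (2 * p.1 / s) * k p.2) • ContinuousLinearMap.fst ℝ ℝ ℝ
        + (deriv A ((p.1 ^ 2 + p.2 ^ 2) / s) * (2 * p.2 / s) * k p.2
            + A ((p.1 ^ 2 + p.2 ^ 2) / s) * k' p.2) • ContinuousLinearMap.snd ℝ ℝ ℝ) p := by
  have h1 : HasFDerivAt (fun r : ℝ × ℝ => r.1) (ContinuousLinearMap.fst ℝ ℝ ℝ) p := hasFDerivAt_fst
  have h2 : HasFDerivAt (fun r : ℝ × ℝ => r.2) (ContinuousLinearMap.snd ℝ ℝ ℝ) p := hasFDerivAt_snd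
  by_cases hy : 1 + p.2 = 0
  · have hu : (p.1 ^ 2 + p.2 ^ 2) / s ∉ tsupport A := fun hmem => by
      have := (hsupp hmem).2
      rw [div_lt_iff₀ hs] at this
      nlinarith [sq_nonneg p.1]
    have hA0 : A ((p.1 ^ 2 + p.2 ^ 2) / s) = 0 := image_eq_zero_of_notMem_tsupport hu
    have hd0 : deriv A ((p.1 ^ 2 + p.2 ^ 2) / s) = 0 :=
      image_eq_zero_of_notMem_tsupport fun h => hu (tsupport_deriv_subset h)
    have hev : (fun r : ℝ × ℝ => A ((r.1 ^ 2 + r.2 ^ 2) / s) * k r.2) =ᶠ[nhds p] fun _ => 0 := by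
      have hc : ContinuousAt (fun r : ℝ × ℝ => (r.1 ^ 2 + r.2 ^ 2) / s) p := by fun_prop
      filter_upwards [hc.eventually (notMem_tsupport_iff_eventuallyEq.mp hu)] with r hr
      simp only [hr, Pi.zero_apply, zero_mul]
    rw [hA0, hd0]
    simpa using (hasFDerivAt_const (0 : ℝ) p).congr_of_eventuallyEq hev
  · have hu : HasFDerivAt (fun r : ℝ × ℝ => (r.1 ^ 2 + r.2 ^ 2) / s) _ p :=
      ((h1.pow 2).add (h2.pow 2)).mul_const s⁻¹
    have hAu := (hA ((p.1 ^ 2 + p.2 ^ 2) / s)).hasDerivAt.comp_hasFDerivAt p hu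
    have hky := (hk p.2 hy).comp_hasFDerivAt p h2
    refine (hAu.mul hky).congr_fderiv ?_
    ext <;> simp <;> ring

lemma hasDerivAt_inv_one_add_sub_one (y : ℝ) (hy : 1 + y ≠ 0) :
    HasDerivAt (fun y : ℝ => (1 + y)⁻¹ - 1) (-((1 + y) ^ 2)⁻¹) y := by
  have h := (((hasDerivAt_id y).const_add 1).inv hy).sub_const 1
  refine h.congr_deriv ?_
  simp [neg_div]

lemma hasDerivAt_neg_inv_one_add_sq (y : ℝ) (hy : 1 + y ≠ 0) :
    HasDerivAt (fun y : ℝ => -((1 + y) ^ 2)⁻¹) (2 * ((1 + y) ^ 3)⁻¹) y := by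
  have h := ((((hasDerivAt_id y).const_add 1).pow 2).inv (pow_ne_zero 2 hy)).neg
  refine h.congr_deriv ?_
  simp
  field_simp

lemma pen_eq_add (Φ : ℝ → ℝ) {s : ℝ} (hs : s ≠ 0) (p : ℝ × ℝ) :
    pen Φ s p = (p.1 ^ 2 + p.2 ^ 2) / 2 + s / 2 *
      ((fun t => t * Φ t) ((p.1 ^ 2 + p.2 ^ 2) / s) * ((1 + p.2)⁻¹ - 1)) := by
  have h : s * ((p.1 ^ 2 + p.2 ^ 2) / s) = p.1 ^ 2 + p.2 ^ 2 := by field_simp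
  simp only [pen, div_eq_mul_inv, mul_inv] at h ⊢
  linear_combination (-(1 / 2) * Φ ((p.1 ^ 2 + p.2 ^ 2) * s⁻¹) * ((1 + p.2)⁻¹ - 1)) * h

section Derivatives

variable {Φ : ℝ → ℝ} {s : ℝ}

lemma tsupport_id_mul_subset (hsupp : tsupport Φ ⊆ Set.Ioo (-(3 / 2) : ℝ) (3 / 2)) :
    tsupport (fun t => t * Φ t) ⊆ Set.Ioo (-(3 / 2) : ℝ) (3 / 2) :=
  (tsupport_mul_subset_right (f := fun t : ℝ => t) (g := Φ)).trans hsupp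

lemma contDiff_id_mul (hΦ : ContDiff ℝ (⊤ : ℕ∞) Φ) :
    ContDiff ℝ (⊤ : ℕ∞) (fun t => t * Φ t) := contDiff_id.mul hΦ

lemma contDiff_deriv_top {f : ℝ → ℝ} (hf : ContDiff ℝ (⊤ : ℕ∞) f) :
    ContDiff ℝ (⊤ : ℕ∞) (deriv f) := (contDiff_infty_iff_deriv.mp hf).2

lemma hasFDerivAt_pen (hΦ : ContDiff ℝ (⊤ : ℕ∞) Φ)
    (hsupp : tsupport Φ ⊆ Set.Ioo (-(3 / 2) : ℝ) (3 / 2)) (hs : 0 < s) (hs' : s < 2 / 3)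
    (p : ℝ × ℝ) :
    HasFDerivAt (pen Φ s)
      ((p.1 + p.1 * (deriv (fun t => t * Φ t) ((p.1 ^ 2 + p.2 ^ 2) / s) * ((1 + p.2)⁻¹ - 1))) •
          ContinuousLinearMap.fst ℝ ℝ ℝ
        + (p.2 + p.2 * (deriv (fun t => t * Φ t) ((p.1 ^ 2 + p.2 ^ 2) / s) * ((1 + p.2)⁻¹ - 1))
          + s / 2 * ((fun t => t * Φ t) ((p.1 ^ 2 + p.2 ^ 2) / s) * -((1 + p.2) ^ 2)⁻¹)) •
          ContinuousLinearMap.snd ℝ ℝ ℝ) p := by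
  have h1 : HasFDerivAt (fun r : ℝ × ℝ => r.1) (ContinuousLinearMap.fst ℝ ℝ ℝ) p := hasFDerivAt_fst
  have h2 : HasFDerivAt (fun r : ℝ × ℝ => r.2) (ContinuousLinearMap.snd ℝ ℝ ℝ) p := hasFDerivAt_snd
  have hg := hasFDerivAt_radial_mul ((contDiff_id_mul hΦ).differentiable (by simp))
    (tsupport_id_mul_subset hsupp) hasDerivAt_inv_one_add_sub_one hs hs' p
  rw [funext (pen_eq_add Φ hs.ne')]
  have hq := ((h1.pow 2).add (h2.pow 2)).mul_const (2⁻¹ : ℝ)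
  refine (hq.add (hg.const_mul (s / 2))).congr_fderiv ?_
  ext <;> simp <;> field_simp
  ring

lemma fderiv_pen_apply (hΦ : ContDiff ℝ (⊤ : ℕ∞) Φ)
    (hsupp : tsupport Φ ⊆ Set.Ioo (-(3 / 2) : ℝ) (3 / 2)) (hs : 0 < s) (hs' : s < 2 / 3)
    (p v : ℝ × ℝ) :
    fderiv ℝ (pen Φ s) p v =
      (p.1 + p.1 * (deriv (fun t => t * Φ t) ((p.1 ^ 2 + p.2 ^ 2) / s) * ((1 + p.2)⁻¹ - 1))) * v.1
        + (p.2 + p.2 * (deriv (fun t => t * Φ t) ((p.1 ^ 2 + p.2 ^ 2) / s) * ((1 + p.2)⁻¹ - 1))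
          + s / 2 * ((fun t => t * Φ t) ((p.1 ^ 2 + p.2 ^ 2) / s) * -((1 + p.2) ^ 2)⁻¹)) * v.2 := by
  rw [(hasFDerivAt_pen hΦ hsupp hs hs' p).fderiv]
  simp

lemma fderiv_fst_fderiv_pen_apply (hΦ : ContDiff ℝ (⊤ : ℕ∞) Φ)
    (hsupp : tsupport Φ ⊆ Set.Ioo (-(3 / 2) : ℝ) (3 / 2)) (hs : 0 < s) (hs' : s < 2 / 3)
    (p v : ℝ × ℝ) :
    fderiv ℝ (fun r => fderiv ℝ (pen Φ s) r (1, 0)) p v =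
      (1 + deriv (fun t => t * Φ t) ((p.1 ^ 2 + p.2 ^ 2) / s) * ((1 + p.2)⁻¹ - 1)
        + deriv (deriv fun t => t * Φ t) ((p.1 ^ 2 + p.2 ^ 2) / s) * (2 * p.1 ^ 2 / s)
          * ((1 + p.2)⁻¹ - 1)) * v.1
      + (deriv (deriv fun t => t * Φ t) ((p.1 ^ 2 + p.2 ^ 2) / s) * (2 * p.1 * p.2 / s)
          * ((1 + p.2)⁻¹ - 1)
        + p.1 * deriv (fun t => t * Φ t) ((p.1 ^ 2 + p.2 ^ 2) / s) * -((1 + p.2) ^ 2)⁻¹) * v.2 := by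
  have h1 : HasFDerivAt (fun r : ℝ × ℝ => r.1) (ContinuousLinearMap.fst ℝ ℝ ℝ) p := hasFDerivAt_fst
  have hd := contDiff_deriv_top (contDiff_id_mul hΦ)
  have hg := hasFDerivAt_radial_mul (hd.differentiable (by simp))
    (tsupport_deriv_subset.trans (tsupport_id_mul_subset hsupp)) hasDerivAt_inv_one_add_sub_one
    hs hs' p
  have hf : (fun r => fderiv ℝ (pen Φ s) r (1, 0)) = fun r => r.1 + r.1 *
      (deriv (fun t => t * Φ t) ((r.1 ^ 2 + r.2 ^ 2) / s) * ((1 + r.2)⁻¹ - 1)) := by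
    funext r
    simp [fderiv_pen_apply hΦ hsupp hs hs']
  rw [hf, (h1.fun_add (h1.fun_mul hg)).fderiv]
  simp
  ring

lemma fderiv_snd_fderiv_pen_apply (hΦ : ContDiff ℝ (⊤ : ℕ∞) Φ)
    (hsupp : tsupport Φ ⊆ Set.Ioo (-(3 / 2) : ℝ) (3 / 2)) (hs : 0 < s) (hs' : s < 2 / 3)
    (p v : ℝ × ℝ) :
    fderiv ℝ (fun r => fderiv ℝ (pen Φ s) r (0, 1)) p v =
      (deriv (deriv fun t => t * Φ t) ((p.1 ^ 2 + p.2 ^ 2) / s) * (2 * p.1 * p.2 / s)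
          * ((1 + p.2)⁻¹ - 1)
        + p.1 * deriv (fun t => t * Φ t) ((p.1 ^ 2 + p.2 ^ 2) / s) * -((1 + p.2) ^ 2)⁻¹) * v.1
      + (1 + deriv (fun t => t * Φ t) ((p.1 ^ 2 + p.2 ^ 2) / s) * ((1 + p.2)⁻¹ - 1)
        + deriv (deriv fun t => t * Φ t) ((p.1 ^ 2 + p.2 ^ 2) / s) * (2 * p.2 ^ 2 / s)
          * ((1 + p.2)⁻¹ - 1)
        + 2 * (p.2 * deriv (fun t => t * Φ t) ((p.1 ^ 2 + p.2 ^ 2) / s) * -((1 + p.2) ^ 2)⁻¹)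
        + s * ((fun t => t * Φ t) ((p.1 ^ 2 + p.2 ^ 2) / s)) * ((1 + p.2) ^ 3)⁻¹) * v.2 := by
  have h2 : HasFDerivAt (fun r : ℝ × ℝ => r.2) (ContinuousLinearMap.snd ℝ ℝ ℝ) p := hasFDerivAt_snd
  have hc := contDiff_id_mul hΦ
  have hsupp' := tsupport_id_mul_subset hsupp
  have hg := hasFDerivAt_radial_mul ((contDiff_deriv_top hc).differentiable (by simp))
    (tsupport_deriv_subset.trans hsupp') hasDerivAt_inv_one_add_sub_one hs hs' p
  have hg' := hasFDerivAt_radial_mul (hc.differentiable (by simp)) hsupp'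
    hasDerivAt_neg_inv_one_add_sq hs hs' p
  have hf : (fun r => fderiv ℝ (pen Φ s) r (0, 1)) = fun r => r.2 + r.2 *
      (deriv (fun t => t * Φ t) ((r.1 ^ 2 + r.2 ^ 2) / s) * ((1 + r.2)⁻¹ - 1))
      + s / 2 * ((fun t => t * Φ t) ((r.1 ^ 2 + r.2 ^ 2) / s) * -((1 + r.2) ^ 2)⁻¹) := by
    funext r
    simp [fderiv_pen_apply hΦ hsupp hs hs']
  rw [hf, ((h2.fun_add (h2.fun_mul hg)).fun_add (hg'.const_mul (s / 2))).fderiv]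
  generalize ((1 + p.2) ^ 2)⁻¹ = k₁
  generalize ((1 + p.2) ^ 3)⁻¹ = k₂
  simp
  field_simp
  ring

end Derivatives

lemma abs_inv_one_add_sub_one_le {y δ : ℝ} (hy : |y| ≤ δ) (hδ : δ ≤ 1 / 2) :
    |(1 + y)⁻¹ - 1| ≤ 2 * δ := by
  have hy' := abs_le.mp hy
  have hpos : 0 < 1 + y := by linarith
  have hinv : (1 + y)⁻¹ ≤ 2 := by
    rw [inv_le_comm₀ hpos two_pos]; linarith
  have : (1 + y)⁻¹ - 1 = (1 + y)⁻¹ * -y := by field_simp; ring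
  rw [this, abs_mul, abs_neg, abs_of_pos (inv_pos.mpr hpos)]
  gcongr

lemma abs_inv_one_add_pow_le {y : ℝ} (hy : |y| ≤ 1 / 2) (n : ℕ) :
    |((1 + y) ^ n)⁻¹| ≤ 2 ^ n := by
  have hy' := abs_le.mp hy
  have hpos : 0 < 1 + y := by linarith
  have hinv : (1 + y)⁻¹ ≤ 2 := by
    rw [inv_le_comm₀ hpos two_pos]; linarith
  rw [← inv_pow, abs_of_pos (by positivity)]
  gcongr

lemma abs_mul_le_of_le {a b A B : ℝ} (ha : |a| ≤ A) (hb : |b| ≤ B) : |a * b| ≤ A * B := by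
  rw [abs_mul]
  exact mul_le_mul ha hb (abs_nonneg _) ((abs_nonneg _).trans ha)

/-- Bounds, by a multiple of `δ`, on the terms occurring in the derivatives of `pen Φ s`. -/
lemma abs_perturbation_le {Ψ Ψ₁ Ψ₂ : ℝ → ℝ} {M δ s : ℝ}
    (hΨ : tsupport Ψ ⊆ Set.Ioo (-(3 / 2) : ℝ) (3 / 2))
    (hΨ₁ : tsupport Ψ₁ ⊆ Set.Ioo (-(3 / 2) : ℝ) (3 / 2))
    (hΨ₂ : tsupport Ψ₂ ⊆ Set.Ioo (-(3 / 2) : ℝ) (3 / 2))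
    (hle : ∀ t, |Ψ t| ≤ |t|) (hM₁ : ∀ t, |Ψ₁ t| ≤ M) (hM₂ : ∀ t, |Ψ₂ t| ≤ M)
    (hδ : 0 < δ) (hδ' : δ ≤ 1 / 2) (hs : 0 < s) (hsδ : 2 * s ≤ δ ^ 2) (x y : ℝ) :
    |s * Ψ ((x ^ 2 + y ^ 2) / s) * ((1 + y)⁻¹ - 1)| ≤ (x ^ 2 + y ^ 2) * (2 * δ) ∧
    |s * Ψ ((x ^ 2 + y ^ 2) / s) * (y * ((1 + y) ^ 2)⁻¹)| ≤ (x ^ 2 + y ^ 2) * (δ * 2 ^ 2) ∧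
    |s * Ψ ((x ^ 2 + y ^ 2) / s) * ((1 + y) ^ 3)⁻¹| ≤ δ ^ 2 * 2 ^ 3 ∧
    |Ψ₁ ((x ^ 2 + y ^ 2) / s) * ((1 + y)⁻¹ - 1)| ≤ M * (2 * δ) ∧
    |x * Ψ₁ ((x ^ 2 + y ^ 2) / s) * -((1 + y) ^ 2)⁻¹| ≤ δ * M * 2 ^ 2 ∧
    |y * Ψ₁ ((x ^ 2 + y ^ 2) / s) * -((1 + y) ^ 2)⁻¹| ≤ δ * M * 2 ^ 2 ∧
    |Ψ₂ ((x ^ 2 + y ^ 2) / s) * (2 * x ^ 2 / s) * ((1 + y)⁻¹ - 1)| ≤ M * 4 * (2 * δ) ∧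
    |Ψ₂ ((x ^ 2 + y ^ 2) / s) * (2 * x * y / s) * ((1 + y)⁻¹ - 1)| ≤ M * 4 * (2 * δ) ∧
    |Ψ₂ ((x ^ 2 + y ^ 2) / s) * (2 * y ^ 2 / s) * ((1 + y)⁻¹ - 1)| ≤ M * 4 * (2 * δ) := by
  have hM : 0 ≤ M := (abs_nonneg _).trans (hM₁ 0)
  by_cases hu : (x ^ 2 + y ^ 2) / s < 3 / 2
  · have hus : x ^ 2 + y ^ 2 ≤ 2 * s := by
      rw [div_lt_iff₀ hs] at hu; linarith
    have hx : |x| ≤ δ := abs_le_of_sq_le_sq (by nlinarith [sq_nonneg y]) hδ.le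
    have hy : |y| ≤ δ := abs_le_of_sq_le_sq (by nlinarith [sq_nonneg x]) hδ.le
    have hk := abs_inv_one_add_sub_one_le hy hδ'
    have hk1 := abs_inv_one_add_pow_le (hy.trans hδ') 2
    have hk1' : |-((1 + y) ^ 2)⁻¹| ≤ 2 ^ 2 := by rwa [abs_neg]
    have hk2 := abs_inv_one_add_pow_le (hy.trans hδ') 3
    have hP : |s * Ψ ((x ^ 2 + y ^ 2) / s)| ≤ x ^ 2 + y ^ 2 := by
      have h0 : 0 ≤ (x ^ 2 + y ^ 2) / s := by positivity
      have h := hle ((x ^ 2 + y ^ 2) / s)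
      rw [abs_of_nonneg h0, le_div_iff₀ hs] at h
      rw [abs_mul, abs_of_pos hs]
      linarith
    have hcoef : ∀ z, |z| ≤ 4 * s → |z / s| ≤ 4 := fun z hz => by
      rwa [abs_div, abs_of_pos hs, div_le_iff₀ hs]
    have hxx : |2 * x ^ 2 / s| ≤ 4 := hcoef _ <| by
      rw [abs_of_nonneg (by positivity)]; nlinarith [sq_nonneg y]
    have hyy : |2 * y ^ 2 / s| ≤ 4 := hcoef _ <| by
      rw [abs_of_nonneg (by positivity)]; nlinarith [sq_nonneg x]
    have hxy : |2 * x * y / s| ≤ 4 := hcoef _ <| by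
      rw [abs_le]; constructor <;> nlinarith [sq_nonneg (x + y), sq_nonneg (x - y)]
    exact ⟨abs_mul_le_of_le hP hk, abs_mul_le_of_le hP (abs_mul_le_of_le hy hk1),
      abs_mul_le_of_le (hP.trans (hus.trans hsδ)) hk2, abs_mul_le_of_le (hM₁ _) hk,
      abs_mul_le_of_le (abs_mul_le_of_le hx (hM₁ _)) hk1',
      abs_mul_le_of_le (abs_mul_le_of_le hy (hM₁ _)) hk1',
      abs_mul_le_of_le (abs_mul_le_of_le (hM₂ _) hxx) hk,
      abs_mul_le_of_le (abs_mul_le_of_le (hM₂ _) hxy) hk,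
      abs_mul_le_of_le (abs_mul_le_of_le (hM₂ _) hyy) hk⟩
  · have h0 : ∀ A : ℝ → ℝ, tsupport A ⊆ Set.Ioo (-(3 / 2) : ℝ) (3 / 2) →
        A ((x ^ 2 + y ^ 2) / s) = 0 := fun A hA =>
      image_eq_zero_of_notMem_tsupport fun h => hu (hA h).2
    rw [h0 Ψ hΨ, h0 Ψ₁ hΨ₁, h0 Ψ₂ hΨ₂]
    simp only [mul_zero, zero_mul, abs_zero]
    refine ⟨?_, ?_, ?_, ?_, ?_, ?_, ?_, ?_, ?_⟩ <;> positivity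

lemma exists_abs_le_of_tsupport_subset_Ioo {f : ℝ → ℝ} {a b : ℝ} (hf : Continuous f)
    (hsupp : tsupport f ⊆ Set.Ioo a b) : ∃ C, ∀ t, |f t| ≤ C :=
  (HasCompactSupport.intro' isCompact_Icc isClosed_Icc fun _ ht =>
    image_eq_zero_of_notMem_tsupport fun h => ht (Set.Ioo_subset_Icc_self (hsupp h))
    : HasCompactSupport f).exists_bound_of_continuous hf

lemma quadratic_form_ge {a b c η : ℝ} (ha : |a - 1| ≤ η) (hb : |b| ≤ η) (hc : |c - 1| ≤ η)
    (x y : ℝ) :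
    (1 - 2 * η) * (x ^ 2 + y ^ 2) ≤ a * x * x + b * x * y + b * y * x + c * y * y := by
  rw [abs_le] at ha hb hc
  nlinarith [mul_nonneg (sub_nonneg.mpr ha.1) (sq_nonneg x),
    mul_nonneg (sub_nonneg.mpr hc.1) (sq_nonneg y),
    mul_nonneg (sub_nonneg.mpr hb.1) (sq_nonneg (x + y)),
    mul_nonneg (sub_nonneg.mpr hb.2) (sq_nonneg (x - y))]

/-- Small-`s` asymptotics of the penalized integrand: for every `ε > 0` there is
`s₀ ∈ (0, 2/3)` such that for all `s ∈ (0, s₀)` and all `p, q ∈ ℝ²`: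
(i) `((1−ε)/2)|p|² ≤ a(p;s) ≤ ((1+ε)/2)|p|²`; (ii) `(1−ε)|p|² ≤ ∇a(p;s)·p ≤ (1+ε)|p|²`;
(iii) `∑ ∂ᵢ∂ⱼa(p;s)qᵢqⱼ ≥ (1−ε)|q|²`; (iv) `|∇(∂₂a)(p;s) − (0,1)| ≤ ε`. -/
theorem pen_small_s_asymptotics
    (Φ : ℝ → ℝ) (hΦ : ContDiff ℝ (⊤ : ℕ∞) Φ)
    (hΦ01 : ∀ t, Φ t ∈ Set.Icc (0 : ℝ) 1)
    (hΦsupp : tsupport Φ ⊆ Set.Ioo (-(3 / 2) : ℝ) (3 / 2))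
    (hΦone : ∀ t ∈ Set.Icc (-1 : ℝ) 1, Φ t = 1) :
    ∀ ε > (0 : ℝ), ∃ s₀ ∈ Set.Ioo (0 : ℝ) (2 / 3), ∀ s ∈ Set.Ioo (0 : ℝ) s₀,
      ∀ p q : ℝ × ℝ,
        ((1 - ε) / 2 * (p.1 ^ 2 + p.2 ^ 2) ≤ pen Φ s p ∧
          pen Φ s p ≤ (1 + ε) / 2 * (p.1 ^ 2 + p.2 ^ 2)) ∧
        ((1 - ε) * (p.1 ^ 2 + p.2 ^ 2) ≤ fderiv ℝ (pen Φ s) p p ∧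
          fderiv ℝ (pen Φ s) p p ≤ (1 + ε) * (p.1 ^ 2 + p.2 ^ 2)) ∧
        (fderiv ℝ (fun r => fderiv ℝ (pen Φ s) r (1, 0)) p (1, 0) * q.1 * q.1
            + fderiv ℝ (fun r => fderiv ℝ (pen Φ s) r (0, 1)) p (1, 0) * q.1 * q.2
            + fderiv ℝ (fun r => fderiv ℝ (pen Φ s) r (1, 0)) p (0, 1) * q.2 * q.1
            + fderiv ℝ (fun r => fderiv ℝ (pen Φ s) r (0, 1)) p (0, 1) * q.2 * q.2
          ≥ (1 - ε) * (q.1 ^ 2 + q.2 ^ 2)) ∧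
        Real.sqrt ((fderiv ℝ (fun r => fderiv ℝ (pen Φ s) r (0, 1)) p (1, 0)) ^ 2
            + (fderiv ℝ (fun r => fderiv ℝ (pen Φ s) r (0, 1)) p (0, 1) - 1) ^ 2) ≤ ε := by
  intro ε hε
  have hc := contDiff_id_mul hΦ
  have hc₁ := contDiff_deriv_top hc
  have hS := tsupport_id_mul_subset hΦsupp
  have hS₁ := (tsupport_deriv_subset (f := fun t => t * Φ t) (𝕜 := ℝ)).trans hS
  have hS₂ := (tsupport_deriv_subset (f := deriv fun t => t * Φ t) (𝕜 := ℝ)).trans hS₁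
  obtain ⟨M₁, hM₁⟩ := exists_abs_le_of_tsupport_subset_Ioo hc₁.continuous hS₁
  obtain ⟨M₂, hM₂⟩ := exists_abs_le_of_tsupport_subset_Ioo
    (contDiff_deriv_top hc₁).continuous hS₂
  obtain ⟨M, hM, hM₁', hM₂'⟩ : ∃ M, 1 ≤ M ∧ M₁ ≤ M ∧ M₂ ≤ M :=
    ⟨max 1 (max M₁ M₂), by simp, by simp, by simp⟩
  have hle : ∀ t, |(fun t => t * Φ t) t| ≤ |t| := fun t => by
    have h := hΦ01 t
    rw [abs_mul, abs_of_nonneg h.1]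
    exact mul_le_of_le_one_right (abs_nonneg t) h.2
  obtain ⟨δ, hδ, hδ', hδε⟩ : ∃ δ > 0, δ ≤ 1 / 2 ∧ 26 * (M * δ) ≤ ε / 2 := by
    refine ⟨min (1 / 2) (ε / (52 * M)), by positivity, min_le_left _ _, ?_⟩
    have h := min_le_right (1 / 2) (ε / (52 * M))
    rw [le_div_iff₀ (by positivity)] at h
    linarith
  refine ⟨δ ^ 2 / 2, ⟨by positivity, by nlinarith⟩, fun s ⟨hs, hsδ⟩ p q => ?_⟩
  have hs' : s < 2 / 3 := by nlinarith
  obtain ⟨b₁, b₂, b₃, b₄, b₅, b₆, b₇, b₈, b₉⟩ :=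
    abs_perturbation_le hS hS₁ hS₂ hle (fun t => (hM₁ t).trans hM₁') (fun t => (hM₂ t).trans hM₂')
      hδ hδ' hs (by linarith) p.1 p.2
  have hMδ : δ ≤ M * δ := by nlinarith
  have hδδ : δ ^ 2 ≤ M * δ := by nlinarith
  have hu : 0 ≤ p.1 ^ 2 + p.2 ^ 2 := by positivity
  have huε : (p.1 ^ 2 + p.2 ^ 2) * (26 * (M * δ)) ≤ (p.1 ^ 2 + p.2 ^ 2) * (ε / 2) := by gcongr
  have huδ : (p.1 ^ 2 + p.2 ^ 2) * δ ≤ (p.1 ^ 2 + p.2 ^ 2) * (M * δ) := by gcongr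
  have huδ' : 0 ≤ (p.1 ^ 2 + p.2 ^ 2) * δ := by positivity
  have b₄' := abs_mul_le_of_le (abs_of_nonneg hu).le b₄
  simp only [fderiv_fst_fderiv_pen_apply hΦ hΦsupp hs hs',
    fderiv_snd_fderiv_pen_apply hΦ hΦsupp hs hs']
  simp only [fderiv_pen_apply hΦ hΦsupp hs hs', pen_eq_add Φ hs.ne', mul_one, mul_zero, add_zero, zero_add]
  generalize (p.1 ^ 2 + p.2 ^ 2) / s * Φ ((p.1 ^ 2 + p.2 ^ 2) / s) = P at *
  generalize deriv (fun t => t * Φ t) ((p.1 ^ 2 + p.2 ^ 2) / s) = P₁ at *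
  generalize deriv (deriv fun t => t * Φ t) ((p.1 ^ 2 + p.2 ^ 2) / s) = P₂ at *
  have h11 : |1 + P₁ * ((1 + p.2)⁻¹ - 1) + P₂ * (2 * p.1 ^ 2 / s) * ((1 + p.2)⁻¹ - 1) - 1|
      ≤ ε / 2 := by
    rw [abs_le] at *
    constructor <;> linarith
  have h12 : |P₂ * (2 * p.1 * p.2 / s) * ((1 + p.2)⁻¹ - 1)
      + p.1 * P₁ * -((1 + p.2) ^ 2)⁻¹| ≤ ε / 2 := by
    rw [abs_le] at *
    constructor <;> linarith
  have h22 : |1 + P₁ * ((1 + p.2)⁻¹ - 1) + P₂ * (2 * p.2 ^ 2 / s) * ((1 + p.2)⁻¹ - 1)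
      + 2 * (p.2 * P₁ * -((1 + p.2) ^ 2)⁻¹) + s * P * ((1 + p.2) ^ 3)⁻¹ - 1| ≤ ε / 2 := by
    rw [abs_le] at *
    constructor <;> linarith
  refine ⟨?_, ?_, ?_, ?_⟩
  · rw [abs_le] at b₁
    constructor <;> linarith
  · rw [abs_le] at b₂ b₄'
    constructor <;> linarith
  · have h := quadratic_form_ge h11 h12 h22 q.1 q.2
    rwa [mul_div_cancel₀ ε two_ne_zero] at h
  · refine Real.sqrt_le_iff.mpr ⟨hε.le, ?_⟩
    have e12 := sq_le_sq' (abs_le.mp h12).1 (abs_le.mp h12).2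
    have e22 := sq_le_sq' (abs_le.mp h22).1 (abs_le.mp h22).2
    linarith [sq_nonneg ε]
end

section
/- Bernoulli function of a flow that is laminar upstream and downstream: let p₀ < 0, let g, c, d, P_atm be real constants with c ≠ 0, let ρ : [p₀,0] → ℝ be positive, continuous, and differentiable, and define the limiting streamline height ẙ(p) := ∫_{p₀}^p ds/(c√(ρ(s))) − d and the hydrostatic streamline pressure P̄(p) := P_atm + g∫_p^0 ρ(s) ẙ′(s) ds. Then the streamline energy E(p) := P̄(p) + ρ(p)c²/2 + gρ(p)ẙ(p) is differentiable on (p₀,0) with E′(p) = ρ′(p)(c²/2 + g ẙ(p)). In particular, the Bernoulli function of such a flow necessarily has the form β(−p) = ρ′(p)[c²/2 + g ẙ(p)]. -/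
open intervalIntegral

/-- The fundamental theorem of calculus for a function continuous on a compact interval, at an
interior point, with respect to the upper endpoint. -/
theorem ContinuousOn.hasDerivAt_integral_right {a b p : ℝ} {f : ℝ → ℝ}
    (hf : ContinuousOn f (Set.Icc a b)) (hp : p ∈ Set.Ioo a b) :
    HasDerivAt (fun q => ∫ s in a..q, f s) (f p) p := by
  refine integral_hasDerivAt_right ?_ ?_ (hf.continuousAt (Icc_mem_nhds hp.1 hp.2))
  · refine (hf.mono ?_).intervalIntegrable
    rw [Set.uIcc_of_le hp.1.le]
    exact Set.Icc_subset_Icc_right hp.2.le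
  · exact (hf.mono Set.Ioo_subset_Icc_self).stronglyMeasurableAtFilter isOpen_Ioo p hp

/-- The fundamental theorem of calculus for a function continuous on a compact interval, at an
interior point, with respect to the lower endpoint. -/
theorem ContinuousOn.hasDerivAt_integral_left {a b p : ℝ} {f : ℝ → ℝ}
    (hf : ContinuousOn f (Set.Icc a b)) (hp : p ∈ Set.Ioo a b) :
    HasDerivAt (fun q => ∫ s in q..b, f s) (-f p) p := by
  refine integral_hasDerivAt_left ?_ ?_ (hf.continuousAt (Icc_mem_nhds hp.1 hp.2))
  · refine (hf.mono ?_).intervalIntegrable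
    rw [Set.uIcc_of_le hp.2.le]
    exact Set.Icc_subset_Icc_left hp.1.le
  · exact (hf.mono Set.Ioo_subset_Icc_self).stronglyMeasurableAtFilter isOpen_Ioo p hp

/-- Bernoulli function of a flow that is laminar upstream and downstream: with limiting
streamline height `ẙ(p) = ∫_{p₀}^p ds/(c√ρ(s)) − d` and hydrostatic streamline pressure
`P̄(p) = P_atm + g∫_p^0 ρ(s)ẙ′(s) ds`, the streamline energy
`E(p) = P̄(p) + ρ(p)c²/2 + gρ(p)ẙ(p)` is differentiable on `(p₀,0)` with
`E′(p) = ρ′(p)(c²/2 + g ẙ(p))`; i.e. the Bernoulli function necessarily has the form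
`β(−p) = ρ′(p)[c²/2 + g ẙ(p)]`. -/
theorem bernoulli_function_of_laminar_flow
    (p₀ g c d Patm : ℝ) (hp₀ : p₀ < 0) (hc : c ≠ 0)
    (ρ : ℝ → ℝ)
    (hρpos : ∀ s ∈ Set.Icc p₀ 0, 0 < ρ s)
    (hρcont : ContinuousOn ρ (Set.Icc p₀ 0))
    (hρdiff : ∀ s ∈ Set.Icc p₀ 0, DifferentiableAt ℝ ρ s) :
    let ylim : ℝ → ℝ := fun p => (∫ s in p₀..p, 1 / (c * Real.sqrt (ρ s))) - d
    let Pbar : ℝ → ℝ := fun p => Patm + g * ∫ s in p..0, ρ s * deriv ylim s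
    let E : ℝ → ℝ := fun p => Pbar p + ρ p * c ^ 2 / 2 + g * ρ p * ylim p
    ∀ p ∈ Set.Ioo p₀ 0, HasDerivAt E (deriv ρ p * (c ^ 2 / 2 + g * ylim p)) p := by
  intro ylim Pbar E p hp
  have hf : ContinuousOn (fun s => 1 / (c * Real.sqrt (ρ s))) (Set.Icc p₀ 0) :=
    continuousOn_const.div (continuousOn_const.mul hρcont.sqrt) fun s hs =>
      mul_ne_zero hc (Real.sqrt_pos.2 (hρpos s hs)).ne'
  have hy : ∀ q ∈ Set.Ioo p₀ 0, HasDerivAt ylim (1 / (c * Real.sqrt (ρ q))) q := fun q hq =>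
    (hf.hasDerivAt_integral_right hq).sub_const d
  have hP : HasDerivAt Pbar (g * -(ρ p * (1 / (c * Real.sqrt (ρ p))))) p := by
    refine ((((hρcont.mul hf).hasDerivAt_integral_left hp).const_mul g).const_add
      Patm).congr_of_eventuallyEq ?_
    filter_upwards [Ioo_mem_nhds hp.1 hp.2] with q hq
    have h : ∫ s in q..0, ρ s * deriv ylim s
        = ∫ s in q..0, ρ s * (1 / (c * Real.sqrt (ρ s))) := by
      rw [integral_of_le hq.2.le, integral_of_le hq.2.le,
        MeasureTheory.integral_Ioc_eq_integral_Ioo, MeasureTheory.integral_Ioc_eq_integral_Ioo]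
      refine MeasureTheory.setIntegral_congr_fun measurableSet_Ioo fun s hs => ?_
      simp only [(hy s ⟨hq.1.trans hs.1, hs.2⟩).deriv]
    simp only [Pbar, h, Pi.mul_apply]
  have hρ := (hρdiff p (Set.Ioo_subset_Icc_self hp)).hasDerivAt
  refine ((hP.add ((hρ.mul_const (c ^ 2)).div_const 2)).add
    ((hρ.const_mul g).mul (hy p hp))).congr_deriv ?_
  ring
end
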